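/- Let {G_k = (V_k, E_k)}_{k ≥ 0} be an increasing sequence of undirected finite connected simple graphs with maximum degree Δ and minimum genus g satisfying assumptions (A1), (A2), (A3). Then for all sufficiently large k there are positive constants A' and c (one may take c = 1/6) such that for every subset W ⊆ V_k there is a subset Z ⊆ W with |Z| ≥ |W|^c / (g + 1) and such that for all distinct u, w ∈ Z, R_{G_k}(u, w) ≥ (A' / (Δ·(g + 1)))·c·log |W|. -/

import Mathlib

open scoped BigOperators

namespace CoverTimePaper

variable {V : Type} [Fintype V]

/-- Degree of a vertex (no decidability assumptions). -/
noncomputable def deg (G : SimpleGraph V) (v : V) : ℕ := Nat.card {u // G.Adj v u}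

/-- Maximum degree. -/
noncomputable def maxDeg (G : SimpleGraph V) : ℕ := ⨆ v : V, deg G v

/-- Number of edges. -/
noncomputable def numEdges {W : Type} (G : SimpleGraph W) : ℕ := Nat.card G.edgeSet

open Classical in
/-- One-step transition probability of the simple random walk. -/
noncomputable def transProb (G : SimpleGraph V) (u v : V) : ℝ :=
  if G.Adj u v then ((deg G u : ℝ))⁻¹ else 0

open Classical in
/-- Probability of a given trajectory of length `t` started at `v`. -/
noncomputable def pathProb (G : SimpleGraph V) (v : V) {t : ℕ} (ω : Fin (t + 1) → V) : ℝ :=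
  (if ω 0 = v then (1 : ℝ) else 0) *
    ∏ i : Fin t, transProb G (ω i.castSucc) (ω i.succ)

open Classical in
/-- Probability that the walk started at `v` has NOT visited all vertices by time `t`. -/
noncomputable def notCoveredProb (G : SimpleGraph V) (v : V) (t : ℕ) : ℝ :=
  ∑ ω : Fin (t + 1) → V, if Set.range ω = Set.univ then 0 else pathProb G v ω

/-- Expected cover time from `v`:  `E_v C = ∑_{t ≥ 0} P(C > t)`. -/
noncomputable def coverTimeFrom (G : SimpleGraph V) (v : V) : ℝ :=
  ∑' t : ℕ, notCoveredProb G v t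

/-- Cover time of the graph: `E_G(C) = max_v E_v(C)`. -/
noncomputable def coverTime (G : SimpleGraph V) : ℝ := ⨆ v : V, coverTimeFrom G v

open Classical in
/-- Probability that the walk started at `v` has not hit `u` by time `t`. -/
noncomputable def notHitProb (G : SimpleGraph V) (u v : V) (t : ℕ) : ℝ :=
  ∑ ω : Fin (t + 1) → V, if (∀ i, ω i ≠ u) then pathProb G v ω else 0

/-- Hitting time `H(u,v)`: expected number of steps for the walk started at `v`
to reach `u`, via `E T = ∑_{t ≥ 0} P(T > t)`. -/
noncomputable def hitTime (G : SimpleGraph V) (u v : V) : ℝ :=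
  ∑' t : ℕ, notHitProb G u v t

/-- Commute time `C(u,v) = H(u,v) + H(v,u)`. -/
noncomputable def commuteTime (G : SimpleGraph V) (u v : V) : ℝ :=
  hitTime G u v + hitTime G v u

/-- Difference time `D(u,v) = H(u,v) - H(v,u)`. -/
noncomputable def diffTime (G : SimpleGraph V) (u v : V) : ℝ :=
  hitTime G u v - hitTime G v u

/-- Dirichlet energy `D(f) = ∑_{{x,y} ∈ E} (f x - f y)^2`. -/
noncomputable def energy (G : SimpleGraph V) (f : V → ℝ) : ℝ :=
  ∑' e : G.edgeSet, Sym2.lift ⟨fun x y => (f x - f y) ^ 2, fun x y => by ring⟩ (e : Sym2 V)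

/-- Effective resistance
`R(u,v) = sup { (f u - f v)^2 / D(f) : f : V → ℝ, D(f) ≠ 0 }`. -/
noncomputable def effRes (G : SimpleGraph V) (u v : V) : ℝ :=
  sSup {x : ℝ | ∃ f : V → ℝ, energy G f ≠ 0 ∧ x = (f u - f v) ^ 2 / energy G f}

/- ### Combinatorial (orientable) genus via rotation systems. -/

/-- Reversal of darts, as a permutation. -/
def dartRev {W : Type} (G : SimpleGraph W) : Equiv.Perm G.Dart :=
  Function.Involutive.toPerm SimpleGraph.Dart.symm fun d => SimpleGraph.Dart.symm_symm d

/-- A rotation system (combinatorial embedding into an orientable surface):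
a permutation of the darts preserving initial vertices and acting cyclically
(i.e. transitively) on the darts with a common initial vertex. -/
structure RotationSystem {W : Type} (G : SimpleGraph W) where
  toPerm : Equiv.Perm G.Dart
  fst_eq : ∀ d : G.Dart, (toPerm d).toProd.1 = d.toProd.1
  cyclic : ∀ d d' : G.Dart, d.toProd.1 = d'.toProd.1 → ∃ n : ℕ, (toPerm ^ n) d = d'

/-- Orbit equivalence of a permutation. -/
def permOrbitSetoid {α : Type} (φ : Equiv.Perm α) : Setoid α where
  r a b := ∃ n : ℤ, (φ ^ n) a = b
  iseqv := by
    constructor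
    · exact fun a => ⟨0, by simp⟩
    · rintro a b ⟨n, rfl⟩
      exact ⟨-n, by simp [← Equiv.Perm.mul_apply, ← zpow_add]⟩
    · rintro a b c ⟨n, rfl⟩ ⟨m, rfl⟩
      exact ⟨m + n, by simp [← Equiv.Perm.mul_apply, ← zpow_add]⟩

/-- Number of orbits of a permutation. -/
noncomputable def numOrbits {α : Type} (φ : Equiv.Perm α) : ℕ :=
  Nat.card (Quotient (permOrbitSetoid φ))

/-- Number of faces of a rotation system: orbits of (rotation ∘ dart-reversal). -/
noncomputable def numFaces {W : Type} {G : SimpleGraph W} (rs : RotationSystem G) : ℕ :=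
  numOrbits (rs.toPerm * dartRev G)

/-- The minimum (orientable) genus of a finite graph.  For connected graphs,
rotation systems are in bijection with 2-cell embeddings into compact orientable
surfaces, and the resulting surface genus `g` is given by Euler's formula
`|V| - |E| + |F| = 2 - 2g`; the minimum genus of a connected graph is attained
by such a 2-cell embedding. -/
noncomputable def minGenus {W : Type} (G : SimpleGraph W) : ℕ :=
  sInf {g : ℕ | ∃ rs : RotationSystem G,
    (Nat.card W : ℤ) - (numEdges G : ℤ) + (numFaces rs : ℤ) = 2 - 2 * (g : ℤ)}

end CoverTimePaper

namespace CoverTimePaper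

/-- A metric on a type, given explicitly (so that a sequence of different metrics on
varying types can be manipulated as data). -/
structure MetricOn (S : Type) where
  d : S → S → ℝ
  d_self : ∀ x, d x x = 0
  d_symm : ∀ x y, d x y = d y x
  d_triangle : ∀ x y z, d x z ≤ d x y + d y z
  eq_of_d_eq_zero : ∀ x y, d x y = 0 → x = y

/-- Sequential compactness of a metric (the appropriate notion of compactness for metric
spaces). -/
def MetricOn.SeqCompact {S : Type} (M : MetricOn S) : Prop :=
  ∀ u : ℕ → S, ∃ x : S, ∃ φ : ℕ → ℕ, StrictMono φ ∧
    Filter.Tendsto (fun m => M.d (u (φ m)) x) Filter.atTop (nhds 0)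

/-- Chain connectedness (equivalent to connectedness for compact metric spaces). -/
def MetricOn.ChainConnected {S : Type} (M : MetricOn S) : Prop :=
  ∀ ε : ℝ, 0 < ε → ∀ x y : S, ∃ m : ℕ, ∃ c : ℕ → S,
    c 0 = x ∧ c m = y ∧ ∀ i < m, M.d (c i) (c (i + 1)) ≤ ε

/-- A univalent circle packing of a graph `G` on a metric surface `(S, M)` which fills the
surface: one circle (center and positive radius) for each vertex, circles of adjacent
vertices are externally tangent, circles of distinct vertices have disjoint interiors, and
every point of the surface lies in the carrier of the packing (formalized metrically:
every point is within distance `2 · radius v` of some center, a surrogate for the carrier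
of disks together with their triangular interstices covering `S`). -/
structure CirclePackingOn {V S : Type} (M : MetricOn S) (G : SimpleGraph V) where
  center : V → S
  radius : V → ℝ
  radius_pos : ∀ v, 0 < radius v
  tangent : ∀ u v, G.Adj u v → M.d (center u) (center v) = radius u + radius v
  univalent : ∀ u v, u ≠ v → radius u + radius v ≤ M.d (center u) (center v)
  fills : ∀ x : S, ∃ v : V, M.d x (center v) ≤ 2 * radius v

/-- The data of an increasing sequence of finite connected graphs `G k` with maximum
degree `Δ` and minimum genus `g`, together with assumptions (A1), (A2), (A3):

* (A1): each `G k` admits a circle packing `P k` filling a compact (connected) genus-`g`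
  Riemann surface `S k`; the surface is recorded by its underlying point set together with
  its intrinsic constant-curvature metric `M k`, and its genus is encoded through the
  requirement `minGenus (G k) = g` — a filling circle packing realizes the graph on a
  surface of its minimal genus.
* (A2): the surfaces `S k` converge to a compact surface `S∞` in moduli, with
  orientation-preserving homeomorphisms `φ k : S∞ → S k` converging to the identity;
  formalized as: the pulled-back metrics converge uniformly to the limit metric.
* (A3): the maximal radius of the circles of `P k` tends to `0` as `k → ∞`. -/
structure JSSequence (Δ g : ℕ) where
  V : ℕ → Type
  instFin : ∀ k, Fintype (V k)
  instNonempty : ∀ k, Nonempty (V k)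
  G : ∀ k, SimpleGraph (V k)
  conn : ∀ k, (G k).Connected
  increasing : ∀ k, Nat.card (V k) < Nat.card (V (k + 1))
  maxdeg : ∀ k, maxDeg (G k) = Δ
  genus : ∀ k, minGenus (G k) = g
  S : ℕ → Type
  M : ∀ k, MetricOn (S k)
  compact : ∀ k, (M k).SeqCompact
  connS : ∀ k, (M k).ChainConnected
  Sinf : Type
  Minf : MetricOn Sinf
  compactInf : Minf.SeqCompact
  connInf : Minf.ChainConnected
  P : ∀ k, CirclePackingOn (M k) (G k)
  φ : ∀ k, Sinf ≃ S k
  φ_conv : ∀ ε : ℝ, 0 < ε → ∃ N : ℕ, ∀ k ≥ N, ∀ x y : Sinf,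
    |(M k).d (φ k x) (φ k y) - Minf.d x y| ≤ ε
  rad_zero : ∀ ε : ℝ, 0 < ε → ∃ N : ℕ, ∀ k ≥ N, ∀ v : V k, (P k).radius v ≤ ε

attribute [instance] JSSequence.instFin JSSequence.instNonempty

end CoverTimePaper

namespace ResAux
open CoverTimePaper Finset
open scoped Classical

variable {V : Type} [Fintype V]

/-- Dirichlet form as a bilinear form. -/
noncomputable def bil (G : SimpleGraph V) (f g : V → ℝ) : ℝ :=
  (1/2) * ∑ v, ∑ w, if G.Adj v w then (f v - f w) * (g v - g w) else 0

lemma bil_comm (G : SimpleGraph V) (f g : V → ℝ) : bil G f g = bil G g f := by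
  unfold bil; congr 1
  refine sum_congr rfl fun v _ => sum_congr rfl fun w _ => ?_
  split_ifs <;> ring

lemma bil_add_left (G : SimpleGraph V) (f f' g : V → ℝ) :
    bil G (f + f') g = bil G f g + bil G f' g := by
  unfold bil; rw [← mul_add]; congr 1
  simp only [← sum_add_distrib]
  refine sum_congr rfl fun v _ => sum_congr rfl fun w _ => ?_
  simp only [Pi.add_apply]
  split_ifs <;> ring

lemma bil_smul_left (G : SimpleGraph V) (c : ℝ) (f g : V → ℝ) :
    bil G (c • f) g = c * bil G f g := by
  unfold bil; rw [mul_left_comm]; congr 1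
  simp only [mul_sum]
  refine sum_congr rfl fun v _ => sum_congr rfl fun w _ => ?_
  simp only [Pi.smul_apply, smul_eq_mul]
  split_ifs <;> ring

lemma bil_sub_left (G : SimpleGraph V) (f f' g : V → ℝ) :
    bil G (f - f') g = bil G f g - bil G f' g := by
  have : f - f' = f + (-1 : ℝ) • f' := by ext; simp; ring
  rw [this, bil_add_left, bil_smul_left]; ring

lemma bil_zero_left (G : SimpleGraph V) (g : V → ℝ) : bil G 0 g = 0 := by
  simp [bil]

lemma bil_sum_left (G : SimpleGraph V) {ι : Type} (s : Finset ι) (f : ι → V → ℝ) (g : V → ℝ) :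
    bil G (∑ i ∈ s, f i) g = ∑ i ∈ s, bil G (f i) g := by
  induction s using Finset.induction_on with
  | empty => simp [bil_zero_left]
  | insert a s ha ih => rw [sum_insert ha, sum_insert ha, bil_add_left, ih]

lemma bil_self_nonneg (G : SimpleGraph V) (f : V → ℝ) : 0 ≤ bil G f f := by
  unfold bil
  refine mul_nonneg (by norm_num) (sum_nonneg fun v _ => sum_nonneg fun w _ => ?_)
  split_ifs
  · exact mul_self_nonneg _
  · exact le_rfl

lemma bil_cs (G : SimpleGraph V) (f g : V → ℝ) :
    (bil G f g) ^ 2 ≤ bil G f f * bil G g g := by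
  have key := Finset.sum_mul_sq_le_sq_mul_sq (univ : Finset (V × V))
    (fun p => if G.Adj p.1 p.2 then f p.1 - f p.2 else 0)
    (fun p => if G.Adj p.1 p.2 then g p.1 - g p.2 else 0)
  have e : ∀ f g : V → ℝ, (∑ v, ∑ w, if G.Adj v w then (f v - f w) * (g v - g w) else 0) =
      ∑ p : V × V, (if G.Adj p.1 p.2 then f p.1 - f p.2 else 0) *
        (if G.Adj p.1 p.2 then g p.1 - g p.2 else 0) := by
    intro f g
    rw [Fintype.sum_prod_type]
    refine sum_congr rfl fun v _ => sum_congr rfl fun w _ => ?_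
    split_ifs <;> simp
  unfold bil
  rw [e, e, e]
  simp only [← sq] at *
  nlinarith [key]

lemma bil_const (G : SimpleGraph V) (c : ℝ) (g : V → ℝ) : bil G (fun _ => c) g = 0 := by
  simp [bil]

lemma bil_eq_lap (G : SimpleGraph V) (f g : V → ℝ) :
    bil G f g = ∑ v, g v * ∑ w, if G.Adj v w then f v - f w else 0 := by
  have h1 : ∑ v, ∑ w, (if G.Adj v w then (f v - f w) * (g v - g w) else 0) =
      (∑ v, ∑ w, (if G.Adj v w then (f v - f w) * (g v) else 0)) -
      (∑ v, ∑ w, (if G.Adj v w then (f v - f w) * (g w) else 0)) := by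
    simp only [← sum_sub_distrib]
    refine sum_congr rfl fun v _ => sum_congr rfl fun w _ => ?_
    split_ifs <;> ring
  have h2 : (∑ v, ∑ w, (if G.Adj v w then (f v - f w) * (g w) else 0)) =
      - (∑ v, ∑ w, (if G.Adj v w then (f v - f w) * (g v) else 0)) := by
    rw [sum_comm]
    simp only [← sum_neg_distrib]
    refine sum_congr rfl fun v _ => sum_congr rfl fun w _ => ?_
    simp only [G.adj_comm w v]
    split_ifs <;> ring
  unfold bil
  rw [h1, h2]
  simp only [mul_sum, mul_ite, mul_zero]
  ring_nf
  refine sum_congr rfl fun v _ => ?_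
  refine sum_congr rfl fun w _ => ?_
  split_ifs <;> ring

lemma eq_of_bil_zero {G : SimpleGraph V} (hc : G.Connected) {f : V → ℝ} (h : bil G f f = 0)
    (u v : V) : f u = f v := by
  have hadj : ∀ a b, G.Adj a b → f a = f b := by
    intro a b hab
    unfold bil at h
    have h' : ∑ v, ∑ w, (if G.Adj v w then (f v - f w) * (f v - f w) else 0) = 0 := by linarith
    have nn : ∀ v w, 0 ≤ (if G.Adj v w then (f v - f w) * (f v - f w) else 0) := by
      intro v w; split_ifs
      · exact mul_self_nonneg _
      · exact le_rfl
    rw [sum_eq_zero_iff_of_nonneg (fun v _ => sum_nonneg fun w _ => nn v w)] at h'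
    have h2 := h' a (mem_univ _)
    rw [sum_eq_zero_iff_of_nonneg (fun w _ => nn a w)] at h2
    have h3 := h2 b (mem_univ _)
    rw [if_pos hab] at h3
    have := mul_self_eq_zero.mp h3
    linarith
  obtain ⟨p⟩ := hc.preconnected u v
  induction p with
  | nil => rfl
  | cons h p ih => rw [hadj _ _ h, ih]

lemma exists_green {G : SimpleGraph V} (hc : G.Connected) :
    ∃ (k : V → V → ℝ) (o : V), ∀ x f, bil G (k x) f = f x - f o := by
  obtain ⟨o⟩ := hc.nonempty
  let T : (V → ℝ) →ₗ[ℝ] (V → ℝ) :=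
    { toFun := fun f v => (∑ w, if G.Adj v w then f v - f w else 0) + if v = o then f o else 0
      map_add' := by
        intro f g; ext v
        simp only [Pi.add_apply]
        rw [add_add_add_comm, ← sum_add_distrib]
        congr 1
        · refine sum_congr rfl fun w _ => ?_
          split_ifs <;> ring
        · split_ifs <;> ring
      map_smul' := by
        intro c f; ext v
        simp only [Pi.smul_apply, smul_eq_mul, RingHom.id_apply, mul_add, mul_sum]
        congr 1
        · refine sum_congr rfl fun w _ => ?_
          split_ifs <;> ring
        · split_ifs <;> ring }
  have hT : ∀ f g, ∑ v, g v * T f v = bil G f g + g o * f o := by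
    intro f g
    rw [bil_eq_lap]
    simp only [T, LinearMap.coe_mk, AddHom.coe_mk, mul_add, sum_add_distrib]
    simp
  have inj : Function.Injective T := by
    rw [← LinearMap.ker_eq_bot, LinearMap.ker_eq_bot']
    intro f hf
    have h := hT f f
    rw [hf] at h
    simp at h
    have h0 := bil_self_nonneg G f
    have h1 : f o * f o = 0 := by nlinarith [mul_self_nonneg (f o)]
    have h2 : bil G f f = 0 := by linarith
    have h3 : f o = 0 := mul_self_eq_zero.mp h1
    ext v
    rw [eq_of_bil_zero hc h2 v o, h3]; rfl
  have sur := LinearMap.injective_iff_surjective.mp inj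
  choose k hk using fun x : V => sur (Pi.single x 1)
  refine ⟨k, o, fun x f => ?_⟩
  have h1 := hT (k x) f
  have h2 := hT (k x) (fun _ => 1)
  rw [hk] at h1 h2
  rw [bil_comm G _ (fun _ => 1), bil_const] at h2
  simp [Pi.single_apply] at h1 h2
  rw [← h2] at h1; linarith

lemma energy_eq (G : SimpleGraph V) (f : V → ℝ) : energy G f = bil G f f := by
  have hfib : ∑ d : G.Dart, (f d.fst - f d.snd)^2 =
      ∑ e ∈ G.edgeFinset, ∑ d ∈ univ.filter (fun d : G.Dart => d.edge = e),
        (f d.fst - f d.snd)^2 := by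
    rw [Finset.sum_fiberwise_of_maps_to]
    intro d _; rw [SimpleGraph.mem_edgeFinset]; exact d.edge_mem
  have h1 : ∀ e ∈ G.edgeFinset, ∑ d ∈ univ.filter (fun d : G.Dart => d.edge = e),
        (f d.fst - f d.snd)^2 = 2 * Sym2.lift ⟨fun x y => (f x - f y) ^ 2, fun x y => by ring⟩ e := by
    intro e he
    rw [SimpleGraph.mem_edgeFinset] at he
    induction e with | _ a b =>
    let d : G.Dart := ⟨(a, b), he⟩
    have : univ.filter (fun d' : G.Dart => d'.edge = s(a,b)) = {d, d.symm} := by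
      have := d.edge_fiber
      convert this
      rfl
    rw [this, sum_pair d.symm_ne.symm]
    simp [d]; ring
  have h2 : ∑ d : G.Dart, (f d.fst - f d.snd)^2 =
      ∑ v, ∑ w, if G.Adj v w then (f v - f w) * (f v - f w) else 0 := by
    rw [← Fintype.sum_prod_type' (f := fun v w => if G.Adj v w then (f v - f w) * (f v - f w) else 0)]
    rw [← sum_filter]
    refine sum_bij (fun d _ => d.toProd) ?_ ?_ ?_ ?_
    · intro d _; simp [d.adj]
    · intro d _ d' _ h; exact SimpleGraph.Dart.ext _ _ h
    · intro p hp; exact ⟨⟨p, (mem_filter.mp hp).2⟩, mem_univ _, rfl⟩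
    · intro d _; ring
  unfold energy bil
  rw [← h2, hfib, sum_congr rfl h1, ← mul_sum, tsum_fintype]
  rw [← mul_assoc]; norm_num
  rw [← Finset.sum_coe_sort G.edgeFinset]
  refine Fintype.sum_equiv (Equiv.subtypeEquivRight (by simp)) _ _ ?_
  intro e; rfl

lemma effRes_ge {G : SimpleGraph V} (k : V → V → ℝ) (o : V)
    (hk : ∀ x f, bil G (k x) f = f x - f o) (x y : V) :
    bil G (k x - k y) (k x - k y) ≤ effRes G x y := by
  have hr : ∀ f, bil G (k x - k y) f = f x - f y := by
    intro f; rw [bil_sub_left, hk, hk]; ring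
  have hbd : BddAbove {r : ℝ | ∃ f : V → ℝ, energy G f ≠ 0 ∧ r = (f x - f y) ^ 2 / energy G f} := by
    refine ⟨bil G (k x - k y) (k x - k y), ?_⟩
    rintro r ⟨f, hf, rfl⟩
    rw [energy_eq] at *
    rw [← hr f, div_le_iff₀ (lt_of_le_of_ne (bil_self_nonneg _ _) (Ne.symm hf))]
    exact bil_cs _ _ _
  by_cases h0 : bil G (k x - k y) (k x - k y) = 0
  · rw [h0]
    apply Real.sSup_nonneg
    rintro r ⟨f, hf, rfl⟩
    rw [energy_eq]
    exact div_nonneg (sq_nonneg _) (bil_self_nonneg _ _)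
  · refine le_csSup hbd ⟨k x - k y, by rwa [energy_eq], ?_⟩
    rw [energy_eq, ← hr, sq, mul_div_assoc, div_self h0, mul_one]

lemma effRes_le {G : SimpleGraph V} (k : V → V → ℝ) (o : V)
    (hk : ∀ x f, bil G (k x) f = f x - f o) (x y : V) :
    effRes G x y ≤ bil G (k x - k y) (k x - k y) := by
  have hr : ∀ f, bil G (k x - k y) f = f x - f y := by
    intro f; rw [bil_sub_left, hk, hk]; ring
  apply Real.sSup_le _ (bil_self_nonneg _ _)
  rintro r ⟨f, hf, rfl⟩
  rw [energy_eq] at *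
  rw [← hr f, div_le_iff₀ (lt_of_le_of_ne (bil_self_nonneg _ _) (Ne.symm hf))]
  exact bil_cs _ _ _

end ResAux

namespace ResAux
open CoverTimePaper Finset
open scoped Classical

variable {V : Type} [Fintype V]

/-- Average of a function over a finite set. -/
noncomputable def avg (U : Finset V) (f : V → ℝ) : ℝ := (∑ x ∈ U, f x) / (#U : ℝ)

/-- The entropy-type quantity of a split. -/
noncomputable def ent (a b : ℝ) : ℝ :=
  (a + b) * Real.log (a + b) - a * Real.log a - b * Real.log b

lemma ent_le {a b : ℝ} (ha : 0 < a) (hb : 0 < b) : ent a b ≤ a * (1 + Real.log ((a + b) / a)) := by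
  have h1 : Real.log ((a + b) / b) ≤ (a + b) / b - 1 := Real.log_le_sub_one_of_pos (by positivity)
  rw [Real.log_div (by positivity) (by positivity)] at *
  have h2 : b * (Real.log (a + b) - Real.log b) ≤ b * ((a + b) / b - 1) :=
    mul_le_mul_of_nonneg_left h1 hb.le
  have h3 : b * ((a + b) / b - 1) = a := by field_simp; ring
  unfold ent
  nlinarith

/-- Concentration hypothesis: no split of `U` has a large gain. -/
def Conc (G : SimpleGraph V) (U : Finset V) (ε : ℝ) : Prop :=
  ∀ A ⊆ U, A.Nonempty → (U \ A).Nonempty → ∀ f : V → ℝ,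
    ((#A : ℝ) * (#(U \ A) : ℝ) / (#U : ℝ)) * (avg A f - avg (U \ A) f) ^ 2 ≤
      ε * ent (#A) (#(U \ A)) * bil G f f

/-- Normalized potential kernel for `U`. -/
structure IsKer (G : SimpleGraph V) (U : Finset V) (γ : V → V → ℝ) : Prop where
  rep : ∀ x f, bil G (γ x) f = f x - avg U f
  mean : ∀ x, avg U (γ x) = 0

lemma IsKer.symm {G : SimpleGraph V} {U : Finset V} {γ : V → V → ℝ} (h : IsKer G U γ) (x y : V) :
    γ x y = γ y x := by
  have h1 := h.rep x (γ y)
  have h2 := h.rep y (γ x)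
  rw [h.mean] at h1 h2
  rw [bil_comm] at h1
  linarith

lemma bil_add_const_left (G : SimpleGraph V) (f g : V → ℝ) (c : ℝ) :
    bil G (fun v => f v - c) g = bil G f g := by
  simp [bil]

lemma exists_ker {G : SimpleGraph V} (k : V → V → ℝ) (o : V)
    (hk : ∀ x f, bil G (k x) f = f x - f o) {U : Finset V} (hU : U.Nonempty) :
    ∃ γ, IsKer G U γ := by
  have hn : (#U : ℝ) ≠ 0 := by exact_mod_cast hU.card_pos.ne'
  let ψ : V → V → ℝ := fun x => k x - ((#U : ℝ)⁻¹) • ∑ u ∈ U, k u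
  refine ⟨fun x v => ψ x v - avg U (ψ x), ?_, ?_⟩
  · intro x f
    rw [bil_add_const_left, bil_sub_left, bil_smul_left, bil_sum_left, hk]
    simp only [hk, sum_sub_distrib, avg]
    simp; field_simp; ring
  · intro x
    unfold avg
    rw [sum_sub_distrib, sum_const, nsmul_eq_mul, mul_div_cancel₀ _ hn]
    simp

lemma bil_min_le (G : SimpleGraph V) (f : V → ℝ) (t : ℝ) :
    bil G (fun v => min (f v) t) (fun v => min (f v) t) ≤ bil G f (fun v => min (f v) t) := by
  unfold bil
  refine mul_le_mul_of_nonneg_left (sum_le_sum fun v _ => sum_le_sum fun w _ => ?_) (by norm_num)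
  split_ifs
  · rcases le_total (f v) t with h1 | h1 <;> rcases le_total (f w) t with h2 | h2 <;>
      simp [h1, h2] <;> nlinarith
  · exact le_rfl

lemma tail {G : SimpleGraph V} {U : Finset V} {γ : V → V → ℝ} (h : IsKer G U γ) {ε : ℝ}
    (hε : 0 < ε) (hC : Conc G U ε) (v : V) {t : ℝ} (ht : 0 < t)
    (hA : (U.filter (fun x => t ≤ γ v x)).Nonempty) :
    t ≤ ε * (1 + Real.log ((#U : ℝ) / #(U.filter (fun x => t ≤ γ v x)))) := by
  set A := U.filter (fun x => t ≤ γ v x) with hAdef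
  have hAU : A ⊆ U := filter_subset _ _
  have hUne : U.Nonempty := hA.mono hAU
  have hn : (0 : ℝ) < #U := by exact_mod_cast hUne.card_pos
  have ha : (0 : ℝ) < #A := by exact_mod_cast hA.card_pos
  set f : V → ℝ := fun x => min (γ v x) t with hf
  have hm0 : avg U f ≤ 0 := by
    rw [← h.mean v]
    unfold avg
    exact div_le_div_of_nonneg_right (sum_le_sum fun x _ => min_le_left _ _) hn.le
  have hD : bil G f f ≤ t - avg U f := by
    refine (bil_min_le G (γ v) t).trans ?_
    rw [h.rep]
    have : min (γ v v) t ≤ t := min_le_right _ _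
    linarith
  have hfA : ∑ x ∈ A, f x = #A * t := by
    rw [← nsmul_eq_mul, ← sum_const]
    refine sum_congr rfl fun x hx => ?_
    exact min_eq_right (mem_filter.mp hx).2
  have hsum : ∑ x ∈ U \ A, f x + ∑ x ∈ A, f x = ∑ x ∈ U, f x := sum_sdiff hAU
  have hmU : ∑ x ∈ U, f x = #U * avg U f := by unfold avg; field_simp
  have hcard : (#(U \ A) : ℝ) + #A = #U := by exact_mod_cast card_sdiff_add_card_eq_card hAU
  have hBne : (U \ A).Nonempty := by
    by_contra hB
    rw [not_nonempty_iff_eq_empty] at hB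
    rw [hB] at hsum hcard
    simp at hsum hcard
    rw [← hsum, hfA, hcard] at hmU
    nlinarith
  have hb : (0 : ℝ) < #(U \ A) := by exact_mod_cast hBne.card_pos
  have hc := hC A hAU hA hBne f
  set τ := t - avg U f with hτ
  set a : ℝ := (#A : ℝ)
  set b : ℝ := (#(U \ A) : ℝ)
  set n : ℝ := (#U : ℝ)
  have hτpos : 0 < τ := by linarith
  have hdiff : avg A f - avg (U \ A) f = n * τ / b := by
    have e1 : avg A f = t := by
      unfold avg; rw [hfA]; exact mul_div_cancel_left₀ _ ha.ne'
    have e2 : avg (U \ A) f = (n * avg U f - a * t) / b := by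
      rw [← hmU]
      unfold avg
      rw [eq_sub_of_add_eq hsum, hfA]
    rw [e1, e2, eq_div_iff hb.ne', sub_mul, div_mul_cancel₀ _ hb.ne', hτ]
    rw [← hcard]; ring
  rw [hdiff] at hc
  have he := ent_le ha hb
  have hcard' : a + b = n := by linarith
  rw [hcard'] at he
  have hlog : 0 ≤ Real.log (n / a) := Real.log_nonneg (by rw [le_div_iff₀ ha]; linarith)
  have e3 : a * b / n * (n * τ / b) ^ 2 = a * n * τ ^ 2 / b := by field_simp
  rw [e3] at hc
  have h5 : a * n * τ ^ 2 / b ≤ ε * (a * (1 + Real.log (n / a))) * τ := by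
    refine hc.trans ?_
    have hn1 : 0 ≤ ε * (a * (1 + Real.log (n / a))) := by positivity
    calc ε * ent a b * bil G f f ≤ ε * (a * (1 + Real.log (n / a))) * bil G f f :=
          mul_le_mul_of_nonneg_right (mul_le_mul_of_nonneg_left he hε.le) (bil_self_nonneg _ _)
      _ ≤ _ := mul_le_mul_of_nonneg_left hD hn1
  have h6 : a * τ * τ ≤ a * τ * (ε * (1 + Real.log (n / a))) := by
    have : a * τ * τ ≤ a * n * τ ^ 2 / b := by
      rw [le_div_iff₀ hb]
      have : 0 ≤ a * τ ^ 2 := by positivity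
      nlinarith
    nlinarith
  have h7 := le_of_mul_le_mul_left h6 (by positivity)
  linarith

lemma tail_count {G : SimpleGraph V} {U : Finset V} {γ : V → V → ℝ} (h : IsKer G U γ) {ε : ℝ}
    (hε : 0 < ε) (hC : Conc G U ε) (v : V) (j : ℕ) :
    (#(U.filter (fun x => j * ε ≤ γ v x)) : ℝ) ≤ 3 * (1/2)^j * #U := by
  rcases Nat.eq_zero_or_pos j with rfl | hj
  · have : (#(U.filter (fun x => ((0:ℕ):ℝ) * ε ≤ γ v x)) : ℝ) ≤ #U := by
      exact_mod_cast card_le_card (filter_subset _ _)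
    have h0 : (0:ℝ) ≤ #U := by positivity
    simp only [pow_zero]
    linarith
  · rcases (U.filter (fun x => j * ε ≤ γ v x)).eq_empty_or_nonempty with he | he
    · rw [he]; simp
    · have hj' : (0:ℝ) < j := by exact_mod_cast hj
      have := tail h hε hC v (t := j * ε) (by positivity) he
      set a : ℝ := (#(U.filter (fun x => j * ε ≤ γ v x)) : ℝ)
      have ha : 0 < a := by simp only [a]; exact_mod_cast he.card_pos
      have hU : (0:ℝ) < #U := by exact_mod_cast (he.mono (filter_subset _ _)).card_pos
      have h1 : (j : ℝ) ≤ 1 + Real.log (#U / a) := by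
        have : ε * j ≤ ε * (1 + Real.log (#U / a)) := by linarith
        exact le_of_mul_le_mul_left this hε
      have h2 : Real.exp (j - 1) ≤ #U / a := by
        rw [← Real.le_log_iff_exp_le (by positivity)]; linarith
      have h3 : (2:ℝ)^j ≤ 3 * Real.exp (j - 1) := by
        have e1 : Real.exp (j:ℝ) = Real.exp 1 ^ j := by rw [← Real.exp_nat_mul]; simp
        have e2 : (2:ℝ)^j ≤ Real.exp 1 ^ j :=
          pow_le_pow_left₀ (by norm_num) (by linarith [Real.add_one_le_exp (1:ℝ)]) j
        have e3 : Real.exp ((j:ℝ) - 1) * Real.exp 1 = Real.exp 1 ^ j := by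
          rw [← e1, ← Real.exp_add]; simp
        have e4 : Real.exp 1 ≤ 3 := by linarith [Real.exp_one_lt_d9]
        nlinarith [Real.exp_pos ((j:ℝ) - 1)]
      have h4 : (2:ℝ)^j * a ≤ 3 * #U := by
        rw [le_div_iff₀ ha] at h2
        nlinarith
      have h5 : (1/2:ℝ)^j * 2^j = 1 := by rw [← mul_pow]; norm_num
      have h6 : (0:ℝ) < (1/2)^j := by positivity
      nlinarith

lemma sum_odd_half (N : ℕ) : ∑ j ∈ range N, (2 * (j:ℝ) + 1) * (1/2)^j ≤ 6 := by
  have : ∑ j ∈ range N, (2 * (j:ℝ) + 1) * (1/2)^j = 6 - (4 * N + 6) * (1/2)^N := by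
    induction N with
    | zero => norm_num
    | succ n ih => rw [sum_range_succ, ih, pow_succ]; push_cast; ring
  rw [this]
  have : (0:ℝ) ≤ (4 * N + 6) * (1/2)^N := by positivity
  linarith

lemma sum_odd (N : ℕ) : ∑ j ∈ range N, (2 * (j:ℝ) + 1) = (N:ℝ)^2 := by
  induction N with
  | zero => simp
  | succ n ih => rw [sum_range_succ, ih]; push_cast; ring

lemma second_moment {G : SimpleGraph V} {U : Finset V} {γ : V → V → ℝ} (h : IsKer G U γ) {ε : ℝ}
    (hε : 0 < ε) (hC : Conc G U ε) (v : V) :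
    ∑ x ∈ U, (max (γ v x) 0) ^ 2 ≤ 18 * ε ^ 2 * #U := by
  obtain ⟨N, hN⟩ := exists_nat_gt (∑ x ∈ U, |γ v x| / ε)
  have hx : ∀ x ∈ U, (max (γ v x) 0) ^ 2 ≤
      ∑ j ∈ range N, ε ^ 2 * ((2 * (j:ℝ) + 1) * (if j * ε ≤ γ v x then 1 else 0)) := by
    intro x hx
    rw [← mul_sum]
    rcases le_total (γ v x) 0 with h0 | h0
    · rw [max_eq_right h0]
      simp only [ne_eq, OfNat.ofNat_ne_zero, not_false_eq_true, zero_pow]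
      refine mul_nonneg (sq_nonneg _) (sum_nonneg fun j _ => ?_)
      split_ifs <;> positivity
    · rw [max_eq_left h0]
      set s := γ v x / ε with hs
      have hs0 : 0 ≤ s := by positivity
      have hsN : s < N := by
        refine lt_of_le_of_lt ?_ hN
        have := single_le_sum (f := fun x => |γ v x| / ε) (fun y _ => by positivity) hx
        refine le_trans ?_ this
        simp only [hs]
        exact div_le_div_of_nonneg_right (le_abs_self _) hε.le
      have hfl : (⌊s⌋₊ + 1) ≤ N := by
        have := (Nat.floor_lt hs0).mpr hsN
        omega
      have e : γ v x = s * ε := by rw [hs]; field_simp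
      have : s ^ 2 ≤ ∑ j ∈ range N, ((2 * (j:ℝ) + 1) * (if j * ε ≤ γ v x then 1 else 0)) := by
        calc s ^ 2 ≤ ((⌊s⌋₊ + 1 : ℕ) : ℝ) ^ 2 := by
              have := Nat.lt_floor_add_one s
              push_cast
              exact pow_le_pow_left₀ hs0 this.le 2
          _ = ∑ j ∈ range (⌊s⌋₊ + 1), (2 * (j:ℝ) + 1) := (sum_odd _).symm
          _ = ∑ j ∈ range (⌊s⌋₊ + 1), ((2 * (j:ℝ) + 1) * (if j * ε ≤ γ v x then 1 else 0)) := by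
              refine sum_congr rfl fun j hj => ?_
              rw [if_pos, mul_one]
              rw [e]
              refine mul_le_mul_of_nonneg_right ?_ hε.le
              have : j ≤ ⌊s⌋₊ := by have := mem_range.mp hj; omega
              exact (Nat.le_floor_iff hs0).mp this
          _ ≤ _ := by
              refine sum_le_sum_of_subset_of_nonneg (range_subset_range.mpr hfl) fun j _ _ => ?_
              split_ifs <;> positivity
      rw [e, mul_pow, mul_comm (s^2)]
      rw [e] at this
      exact mul_le_mul_of_nonneg_left this (sq_nonneg _)
  refine (sum_le_sum hx).trans ?_
  rw [sum_comm]
  have : ∀ j ∈ range N, ∑ x ∈ U, ε ^ 2 * ((2 * (j:ℝ) + 1) * (if j * ε ≤ γ v x then 1 else 0)) ≤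
      3 * ε ^ 2 * #U * ((2 * (j:ℝ) + 1) * (1/2)^j) := by
    intro j _
    rw [← mul_sum, ← mul_sum, ← sum_filter, sum_const, nsmul_eq_mul, mul_one]
    have := tail_count h hε hC v j
    calc ε ^ 2 * ((2 * (j:ℝ) + 1) * (#(U.filter (fun x => j * ε ≤ γ v x)) : ℝ))
        ≤ ε ^ 2 * ((2 * (j:ℝ) + 1) * (3 * (1/2)^j * #U)) := by gcongr
      _ = _ := by ring
  refine (sum_le_sum this).trans ?_
  rw [← mul_sum]
  have h6 := sum_odd_half N
  have : 0 ≤ 3 * ε ^ 2 * (#U : ℝ) := by positivity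
  nlinarith

end ResAux

namespace ResAux
open CoverTimePaper Finset
open scoped Classical

variable {V : Type} [Fintype V]

/-- Concave truncation. -/
noncomputable def FF (ε s : ℝ) : ℝ := if s ≤ 0 then s else ε * s / (ε + s)

/-- Weight dual to the truncation. -/
noncomputable def wt (ε s : ℝ) : ℝ := (1 + max s 0 / ε) ^ 2

lemma FF_ineq_aux {ε : ℝ} (hε : 0 < ε) {s t : ℝ} (hst : t ≤ s) :
    (s - t) ^ 2 ≤ (s - t) * (FF ε s - FF ε t) * (wt ε s + wt ε t) := by
  have h0 : 0 ≤ s - t := by linarith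
  suffices s - t ≤ (FF ε s - FF ε t) * (wt ε s + wt ε t) by nlinarith
  unfold FF wt
  rcases le_or_gt s 0 with hs | hs
  · have ht : t ≤ 0 := by linarith
    simp [hs, ht]; nlinarith
  · rcases le_or_gt t 0 with ht | ht
    · simp only [hs.not_ge, ht, if_true, if_false, max_eq_left hs.le, max_eq_right ht]
      have e : (ε * s / (ε + s) - t) * ((1 + s / ε)^2 + (1 + 0 / ε)^2) - (s - t) =
          (s * s / ε + (-t) * (2 * ε * s + s ^ 2) / ε ^ 2) + (ε * s / (ε + s) + (-t)) := by
        field_simp; ring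
      have : 0 ≤ (s * s / ε + (-t) * (2 * ε * s + s ^ 2) / ε ^ 2) + (ε * s / (ε + s) + (-t)) := by
        have : 0 ≤ -t := by linarith
        positivity
      linarith
    · simp only [hs.not_ge, ht.not_ge, if_false, max_eq_left hs.le, max_eq_left ht.le]
      have e : (ε * s / (ε + s) - ε * t / (ε + t)) * ((1 + s / ε)^2 + (1 + t / ε)^2) =
          (s - t) * ((ε + s)/(ε + t) + (ε + t) / (ε + s)) := by
        field_simp; ring
      rw [e]
      have h1 : 1 ≤ (ε + s)/(ε + t) := by rw [le_div_iff₀ (by linarith)]; linarith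
      have h2 : 0 ≤ (ε + t) / (ε + s) := by positivity
      nlinarith

lemma FF_ineq {ε : ℝ} (hε : 0 < ε) (s t : ℝ) :
    (s - t) ^ 2 ≤ (s - t) * (FF ε s - FF ε t) * (wt ε s + wt ε t) := by
  rcases le_total t s with h | h
  · exact FF_ineq_aux hε h
  · have := FF_ineq_aux hε h
    nlinarith

lemma FF_le {ε : ℝ} (hε : 0 < ε) (s : ℝ) : FF ε s ≤ ε := by
  unfold FF; split_ifs with h
  · linarith
  · have : 0 < s := by linarith
    rw [div_le_iff₀ (by linarith)]; nlinarith

lemma FF_ge {ε : ℝ} (hε : 0 < ε) (s : ℝ) : s - max s 0 ≤ FF ε s := by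
  unfold FF; split_ifs with h
  · rw [max_eq_right h]; linarith
  · have : 0 < s := by linarith
    rw [max_eq_left this.le]
    have : 0 ≤ ε * s / (ε + s) := by positivity
    linarith

lemma wt_pos {ε : ℝ} (hε : 0 < ε) (s : ℝ) : 0 < wt ε s := by
  unfold wt
  have : 0 ≤ max s 0 := le_max_right _ _
  positivity

lemma sum_wt {G : SimpleGraph V} {U : Finset V} {γ : V → V → ℝ} (h : IsKer G U γ) {ε : ℝ}
    (hε : 0 < ε) (hC : Conc G U ε) (v : V) :
    ∑ x ∈ U, wt ε (γ x v) ≤ 38 * #U := by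
  have h1 : ∀ x ∈ U, wt ε (γ x v) ≤ 2 + 2 / ε ^ 2 * (max (γ v x) 0) ^ 2 := by
    intro x _
    rw [h.symm x v]
    unfold wt
    have : 2 + 2 / ε ^ 2 * (max (γ v x) 0) ^ 2 = 2 + 2 * (max (γ v x) 0 / ε) ^ 2 := by
      field_simp
    rw [this]
    nlinarith [sq_nonneg (1 - max (γ v x) 0 / ε)]
  refine (sum_le_sum h1).trans ?_
  rw [sum_add_distrib, ← mul_sum, sum_const, nsmul_eq_mul]
  have h2 := second_moment h hε hC v
  have h3 : 2 / ε ^ 2 * ∑ x ∈ U, (max (γ v x) 0) ^ 2 ≤ 2 / ε ^ 2 * (18 * ε ^ 2 * #U) :=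
    mul_le_mul_of_nonneg_left h2 (by positivity)
  have h4 : 2 / ε ^ 2 * (18 * ε ^ 2 * (#U:ℝ)) = 36 * #U := by field_simp; ring
  linarith

lemma first_moment {G : SimpleGraph V} {U : Finset V} {γ : V → V → ℝ} (h : IsKer G U γ) {ε : ℝ}
    (hε : 0 < ε) (hC : Conc G U ε) (v : V) :
    ∑ x ∈ U, max (γ v x) 0 ≤ 10 * ε * #U := by
  have h1 : ∀ x ∈ U, max (γ v x) 0 ≤ ε / 2 + 1 / (2 * ε) * (max (γ v x) 0) ^ 2 := by
    intro x _
    have : ε / 2 + 1 / (2 * ε) * (max (γ v x) 0) ^ 2 - max (γ v x) 0 =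
      1 / (2 * ε) * (ε - max (γ v x) 0) ^ 2 := by field_simp; ring
    have : 0 ≤ 1 / (2 * ε) * (ε - max (γ v x) 0) ^ 2 := by positivity
    linarith
  refine (sum_le_sum h1).trans ?_
  rw [sum_add_distrib, ← mul_sum, sum_const, nsmul_eq_mul]
  have h2 := second_moment h hε hC v
  have h3 : 1 / (2 * ε) * ∑ x ∈ U, (max (γ v x) 0) ^ 2 ≤ 1 / (2 * ε) * (18 * ε ^ 2 * #U) :=
    mul_le_mul_of_nonneg_left h2 (by positivity)
  have h4 : 1 / (2 * ε) * (18 * ε ^ 2 * (#U:ℝ)) = 9 * ε * #U := by field_simp; ring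
  have : 0 ≤ ε * (#U : ℝ) := by positivity
  linarith

lemma bil_FF {G : SimpleGraph V} {U : Finset V} {γ : V → V → ℝ} (h : IsKer G U γ) {ε : ℝ}
    (hε : 0 < ε) (hC : Conc G U ε) (hU : U.Nonempty) (x : V) :
    bil G (γ x) (fun v => FF ε (γ x v)) ≤ 11 * ε := by
  have hn : (0 : ℝ) < #U := by exact_mod_cast hU.card_pos
  rw [h.rep]
  have h1 := FF_le hε (γ x x)
  have h2 : -(10 * ε) ≤ avg U (fun v => FF ε (γ x v)) := by
    unfold avg
    rw [le_div_iff₀ hn]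
    have e1 : ∑ v ∈ U, (γ x v - max (γ x v) 0) ≤ ∑ v ∈ U, FF ε (γ x v) :=
      sum_le_sum fun v _ => FF_ge hε _
    rw [sum_sub_distrib] at e1
    have e2 : ∑ v ∈ U, γ x v = 0 := by
      have := h.mean x
      unfold avg at this
      rcases div_eq_zero_iff.mp this with h | h
      · exact h
      · exact absurd h hn.ne'
    have := first_moment h hε hC x
    linarith
  linarith

lemma flow_sum {G : SimpleGraph V} {U : Finset V} {γ : V → V → ℝ} (h : IsKer G U γ) {ε : ℝ}
    (hε : 0 < ε) (hC : Conc G U ε) (hU : U.Nonempty) :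
    ∑ v, ∑ w, (if G.Adj v w then (∑ x ∈ U, |γ x v - γ x w|) ^ 2 else 0) ≤ 1672 * ε * (#U : ℝ) ^ 2 := by
  have hn : (0 : ℝ) < #U := by exact_mod_cast hU.card_pos
  have h1 : ∀ v w, (∑ x ∈ U, |γ x v - γ x w|) ^ 2 ≤
      (76 * #U) * ∑ x ∈ U, (γ x v - γ x w) * (FF ε (γ x v) - FF ε (γ x w)) := by
    intro v w
    have hg : ∀ x ∈ U, 0 < wt ε (γ x v) + wt ε (γ x w) := fun x _ =>
      add_pos (wt_pos hε _) (wt_pos hε _)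
    have hs := sq_sum_div_le_sum_sq_div U (fun x => |γ x v - γ x w|) hg
    have hsw : ∑ x ∈ U, (wt ε (γ x v) + wt ε (γ x w)) ≤ 76 * #U := by
      rw [sum_add_distrib]
      linarith [sum_wt h hε hC v, sum_wt h hε hC w]
    have hspos : 0 < ∑ x ∈ U, (wt ε (γ x v) + wt ε (γ x w)) := sum_pos hg hU
    have h2 : ∑ x ∈ U, |γ x v - γ x w| ^ 2 / (wt ε (γ x v) + wt ε (γ x w)) ≤
        ∑ x ∈ U, (γ x v - γ x w) * (FF ε (γ x v) - FF ε (γ x w)) := by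
      refine sum_le_sum fun x hx => ?_
      rw [div_le_iff₀ (hg x hx), sq_abs]
      exact FF_ineq hε _ _
    have h3 := hs.trans h2
    rw [div_le_iff₀ hspos] at h3
    have h4 : 0 ≤ ∑ x ∈ U, (γ x v - γ x w) * (FF ε (γ x v) - FF ε (γ x w)) :=
      le_trans (sum_nonneg fun x hx => div_nonneg (sq_nonneg _) (hg x hx).le) h2
    nlinarith
  have h5 : ∑ v, ∑ w, (if G.Adj v w then (∑ x ∈ U, |γ x v - γ x w|) ^ 2 else 0) ≤
      ∑ v, ∑ w, (76 * #U) * ∑ x ∈ U,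
        (if G.Adj v w then (γ x v - γ x w) * (FF ε (γ x v) - FF ε (γ x w)) else 0) := by
    refine sum_le_sum fun v _ => sum_le_sum fun w _ => ?_
    split_ifs
    · exact h1 v w
    · simp
  refine h5.trans ?_
  simp only [← mul_sum]
  have h6 : ∑ v, ∑ w, ∑ x ∈ U,
        (if G.Adj v w then (γ x v - γ x w) * (FF ε (γ x v) - FF ε (γ x w)) else 0) =
      ∑ x ∈ U, 2 * bil G (γ x) (fun v => FF ε (γ x v)) := by
    have : ∀ v, ∑ w, ∑ x ∈ U,
        (if G.Adj v w then (γ x v - γ x w) * (FF ε (γ x v) - FF ε (γ x w)) else 0) =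
        ∑ x ∈ U, ∑ w,
        (if G.Adj v w then (γ x v - γ x w) * (FF ε (γ x v) - FF ε (γ x w)) else 0) :=
      fun v => sum_comm
    rw [sum_congr rfl fun v _ => this v, sum_comm]
    refine sum_congr rfl fun x _ => ?_
    unfold bil; ring
  rw [h6]
  have h7 : ∑ x ∈ U, 2 * bil G (γ x) (fun v => FF ε (γ x v)) ≤ ∑ x ∈ U, 22 * ε :=
    sum_le_sum fun x _ => by linarith [bil_FF h hε hC hU x]
  rw [sum_const, nsmul_eq_mul] at h7
  nlinarith

/-- Vertex load of the flow out of `x`. -/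
noncomputable def load (G : SimpleGraph V) (γ : V → V → ℝ) (x v : V) : ℝ :=
  (if v = x then 1 else 0) + ∑ w, if G.Adj v w then |γ x v - γ x w| else 0

lemma load_nonneg (G : SimpleGraph V) (γ : V → V → ℝ) (x v : V) : 0 ≤ load G γ x v := by
  unfold load
  refine add_nonneg (by split_ifs <;> norm_num) (sum_nonneg fun w _ => ?_)
  split_ifs
  · exact abs_nonneg _
  · exact le_rfl

lemma inv_card_le {G : SimpleGraph V} {U : Finset V} {ε : ℝ} (hε : 0 < ε) (hC : Conc G U ε)
    (hU : 2 ≤ #U) {Δ : ℕ} (hdeg : ∀ v, #(univ.filter (fun w => G.Adj v w)) ≤ Δ) :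
    1 / (#U : ℝ) ≤ 2 * ε * Δ := by
  obtain ⟨x, hx⟩ : U.Nonempty := card_pos.mp (by omega)
  have hxU : ({x} : Finset V) ⊆ U := by simpa using hx
  have hcard : (#(U \ {x}) : ℝ) + 1 = #U := by
    have := card_sdiff_add_card_eq_card hxU
    rw [card_singleton] at this
    exact_mod_cast this
  have hn : (2:ℝ) ≤ #U := by exact_mod_cast hU
  have hne : (U \ {x}).Nonempty := by
    rw [← card_pos]
    have : (0:ℝ) < #(U \ {x}) := by linarith
    exact_mod_cast this
  have hc := hC {x} hxU (singleton_nonempty x) hne (Pi.single x 1)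
  have e1 : avg {x} (Pi.single x (1:ℝ)) = 1 := by simp [avg]
  have e2 : avg (U \ {x}) (Pi.single x (1:ℝ)) = 0 := by
    unfold avg
    rw [sum_eq_zero, zero_div]
    intro y hy
    have : y ≠ x := by simp at hy; exact hy.2
    simp [this]
  have e3 : bil G (Pi.single x (1:ℝ)) (Pi.single x (1:ℝ)) ≤ Δ := by
    rw [bil_eq_lap]
    have : ∑ v, (Pi.single x (1:ℝ) : V → ℝ) v * ∑ w, (if G.Adj v w then
        (Pi.single x (1:ℝ) : V → ℝ) v - (Pi.single x (1:ℝ) : V → ℝ) w else 0) =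
        #(univ.filter (fun w => G.Adj x w)) := by
      rw [Finset.sum_eq_single x]
      · rw [Pi.single_eq_same, one_mul, ← sum_filter, ← nsmul_one, ← sum_const]
        refine sum_congr rfl fun w hw => ?_
        have : w ≠ x := (mem_filter.mp hw).2.ne'
        simp [this]
      · intro v _ hv; simp [hv]
      · simp
    rw [this]; exact_mod_cast hdeg x
  rw [e1, e2, card_singleton] at hc
  set b : ℝ := (#(U \ {x}) : ℝ)
  set n : ℝ := (#U : ℝ)
  have hb : 1 ≤ b := by linarith
  have e4 : ent 1 b ≤ n := by
    have := ent_le (a := 1) (b := b) one_pos (by linarith)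
    have h2 : Real.log ((1 + b) / 1) ≤ (1 + b) / 1 - 1 := Real.log_le_sub_one_of_pos (by simp; linarith)
    linarith
  have e5 : ε * ent 1 b * bil G (Pi.single x (1:ℝ)) (Pi.single x (1:ℝ)) ≤ ε * n * Δ := by
    calc _ ≤ ε * n * bil G (Pi.single x (1:ℝ)) (Pi.single x (1:ℝ)) :=
          mul_le_mul_of_nonneg_right (mul_le_mul_of_nonneg_left e4 hε.le) (bil_self_nonneg _ _)
      _ ≤ _ := mul_le_mul_of_nonneg_left e3 (by positivity)
  have e6 : 1 / 2 ≤ b / n := by rw [le_div_iff₀ (by linarith)]; linarith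
  rw [div_le_iff₀ (by linarith)]
  simp only [Nat.cast_one, one_mul, sub_zero, one_pow, mul_one] at hc
  nlinarith

lemma load_avg {G : SimpleGraph V} {U : Finset V} {γ : V → V → ℝ} (h : IsKer G U γ) {ε : ℝ}
    (hε : 0 < ε) (hC : Conc G U ε) (hU : 2 ≤ #U) {Δ : ℕ}
    (hdeg : ∀ v, #(univ.filter (fun w => G.Adj v w)) ≤ Δ) :
    ∑ v, ((∑ x ∈ U, load G γ x v) / #U) ^ 2 ≤ 4000 * ε * Δ := by
  have hUne : U.Nonempty := card_pos.mp (by omega)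
  have hn : (0 : ℝ) < #U := by exact_mod_cast hUne.card_pos
  have h1 : ∀ v, (∑ x ∈ U, load G γ x v) =
      (if v ∈ U then 1 else 0) + ∑ w ∈ univ.filter (fun w => G.Adj v w), ∑ x ∈ U, |γ x v - γ x w| := by
    intro v
    unfold load
    rw [sum_add_distrib, sum_ite_eq, sum_comm, sum_filter]
    congr 1
    refine sum_congr rfl fun w _ => ?_
    split_ifs <;> simp
  have h2 : ∀ v, ((∑ x ∈ U, load G γ x v) / #U) ^ 2 ≤ (2 / (#U : ℝ)^2) * (if v ∈ U then 1 else 0) +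
      (2 * Δ / (#U : ℝ)^2) * ∑ w, (if G.Adj v w then (∑ x ∈ U, |γ x v - γ x w|) ^ 2 else 0) := by
    intro v
    rw [h1, div_pow, ← sum_filter]
    have hcs := sq_sum_le_card_mul_sum_sq (s := univ.filter (fun w => G.Adj v w))
      (f := fun w => ∑ x ∈ U, |γ x v - γ x w|)
    set S := ∑ w ∈ univ.filter (fun w => G.Adj v w), ∑ x ∈ U, |γ x v - γ x w|
    set T := ∑ w ∈ univ.filter (fun w => G.Adj v w), (∑ x ∈ U, |γ x v - γ x w|) ^ 2
    have hT : 0 ≤ T := sum_nonneg fun w _ => sq_nonneg _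
    have hd : (#(univ.filter (fun w => G.Adj v w)) : ℝ) ≤ Δ := by exact_mod_cast hdeg v
    have h3 : S ^ 2 ≤ Δ * T := hcs.trans (mul_le_mul_of_nonneg_right hd hT)
    set c : ℝ := (if v ∈ U then 1 else 0)
    have hc : c ^ 2 = c := by simp only [c]; split_ifs <;> norm_num
    have : (c + S) ^ 2 ≤ 2 * c + 2 * Δ * T := by nlinarith [sq_nonneg (c - S)]
    calc (c + S)^2 / (#U : ℝ)^2 ≤ (2 * c + 2 * Δ * T) / (#U : ℝ)^2 := by gcongr
      _ = _ := by ring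
  refine (sum_le_sum fun v _ => h2 v).trans ?_
  rw [sum_add_distrib, ← mul_sum, ← mul_sum]
  have e1 : ∑ v, (if v ∈ U then (1:ℝ) else 0) = #U := by simp
  rw [e1]
  have e2 := flow_sum h hε hC hUne
  have e3 := inv_card_le hε hC hU hdeg
  have e4 : 2 / (#U:ℝ)^2 * #U = 2 * (1 / #U) := by field_simp
  have e5 : 2 * Δ / (#U : ℝ)^2 * ∑ v, ∑ w, (if G.Adj v w then (∑ x ∈ U, |γ x v - γ x w|) ^ 2 else 0)
      ≤ 2 * Δ / (#U : ℝ)^2 * (1672 * ε * (#U : ℝ) ^ 2) := mul_le_mul_of_nonneg_left e2 (by positivity)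
  have e6 : 2 * Δ / (#U : ℝ)^2 * (1672 * ε * (#U : ℝ) ^ 2) = 3344 * ε * Δ := by field_simp; ring
  have : 0 ≤ ε * (Δ:ℝ) := by positivity
  rw [e4]
  linarith

end ResAux

namespace ResAux
open CoverTimePaper Finset
open scoped Classical

set_option linter.unusedSectionVars false

variable {V : Type} [Fintype V]

/-- Walks of cost at most the load. -/
lemma path_lemma {G : SimpleGraph V} (hc : G.Connected) {U : Finset V} {γ : V → V → ℝ}
    (h : IsKer G U γ) (x y : V) (c : V → ℝ) (hc0 : ∀ v, 0 ≤ c v) :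
    ∃ p : G.Walk x y, ∑ v ∈ p.support.toFinset, c v ≤
      ∑ v, (load G γ x v + load G γ y v) * c v := by
  have hmin : ∀ v, ∃ p : G.Walk x v, ∀ q : G.Walk x v,
      ∑ u ∈ p.support.toFinset, c u ≤ ∑ u ∈ q.support.toFinset, c u := by
    intro v
    let S : Finset (Finset V) := univ.filter (fun T => ∃ p : G.Walk x v, p.support.toFinset = T)
    have hS : S.Nonempty := by
      obtain ⟨p⟩ := hc.preconnected x v
      exact ⟨p.support.toFinset, by simp only [S, mem_filter, mem_univ, true_and]; exact ⟨p, rfl⟩⟩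
    obtain ⟨T, hT, hTm⟩ := exists_min_image S (fun T => ∑ u ∈ T, c u) hS
    simp only [S, mem_filter, mem_univ, true_and] at hT
    obtain ⟨p, rfl⟩ := hT
    exact ⟨p, fun q => hTm _ (by simp only [S, mem_filter, mem_univ, true_and]; exact ⟨q, rfl⟩)⟩
  choose p hp using hmin
  refine ⟨p y, ?_⟩
  set D : V → ℝ := fun v => ∑ u ∈ (p v).support.toFinset, c u with hD
  have hstep : ∀ v w, G.Adj v w → D w ≤ D v + c w := by
    intro v w hvw
    refine (hp w ((p v).concat hvw)).trans ?_
    have : ((p v).concat hvw).support.toFinset = insert w (p v).support.toFinset := by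
      ext u; simp [SimpleGraph.Walk.support_concat]
    rw [this]
    by_cases hw : w ∈ (p v).support.toFinset
    · rw [insert_eq_of_mem hw]; have := hc0 w; simp only [hD]; linarith
    · rw [sum_insert hw]; simp only [hD]; linarith
  have habs : ∀ v w, G.Adj v w → |D v - D w| ≤ c v + c w := by
    intro v w hvw
    have h1 := hstep v w hvw
    have h2 := hstep w v hvw.symm
    have h3 := hc0 v
    have h4 := hc0 w
    rw [abs_le]; constructor <;> linarith
  have hx : D x ≤ c x := by
    have := hp x SimpleGraph.Walk.nil
    simpa using this
  have hrep : bil G (γ y) D - bil G (γ x) D = D y - D x := by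
    rw [h.rep, h.rep]; ring
  have hb : ∀ z, |bil G (γ z) D| ≤ ∑ v, c v * ∑ w, if G.Adj v w then |γ z v - γ z w| else 0 := by
    intro z
    unfold bil
    have e : ∑ v, c v * (∑ w, if G.Adj v w then |γ z v - γ z w| else 0)
        = 1/2 * ∑ v, ∑ w, (if G.Adj v w then |γ z v - γ z w| * (c v + c w) else 0) := by
      have e1 : ∑ v, ∑ w, (if G.Adj v w then |γ z v - γ z w| * (c v + c w) else 0)
        = ∑ v, ∑ w, (if G.Adj v w then |γ z v - γ z w| * c v else 0)
          + ∑ v, ∑ w, (if G.Adj v w then |γ z v - γ z w| * c w else 0) := by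
        simp only [← sum_add_distrib]
        refine sum_congr rfl fun v _ => sum_congr rfl fun w _ => ?_
        split_ifs <;> ring
      have e2 : ∑ v, ∑ w, (if G.Adj v w then |γ z v - γ z w| * c w else 0)
        = ∑ v, ∑ w, (if G.Adj v w then |γ z v - γ z w| * c v else 0) := by
        rw [sum_comm]
        refine sum_congr rfl fun v _ => sum_congr rfl fun w _ => ?_
        simp only [G.adj_comm v w, abs_sub_comm (γ z v)]
      have e3 : ∑ v, c v * (∑ w, if G.Adj v w then |γ z v - γ z w| else 0)
         = ∑ v, ∑ w, (if G.Adj v w then |γ z v - γ z w| * c v else 0) := by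
        refine sum_congr rfl fun v _ => ?_
        rw [mul_sum]
        refine sum_congr rfl fun w _ => ?_
        split_ifs <;> ring
      rw [e1, e2, e3]; ring
    rw [e]
    rw [abs_mul]
    rw [show |(1/2:ℝ)| = 1/2 by norm_num]
    refine mul_le_mul_of_nonneg_left ?_ (by norm_num)
    refine (abs_sum_le_sum_abs _ _).trans (sum_le_sum fun v _ => ?_)
    refine (abs_sum_le_sum_abs _ _).trans (sum_le_sum fun w _ => ?_)
    split_ifs with hvw
    · rw [abs_mul]
      exact mul_le_mul_of_nonneg_left (habs v w hvw) (abs_nonneg _)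
    · simp
  have hl : ∀ z, ∑ v, load G γ z v * c v = c z +
      ∑ v, c v * ∑ w, if G.Adj v w then |γ z v - γ z w| else 0 := by
    intro z
    unfold load
    simp only [add_mul, sum_add_distrib]
    congr 1
    · simp
    · refine sum_congr rfl fun v _ => by ring
  simp only [add_mul, sum_add_distrib]
  rw [hl x, hl y]
  have h1 := abs_le.1 (hb x)
  have h2 := abs_le.1 (hb y)
  have h3 := hc0 y
  have : D y ≤ D x + (bil G (γ y) D - bil G (γ x) D) := by linarith
  show D y ≤ _
  linarith

lemma sum_split {ι : Type} [Fintype ι] (K : ι → ι → ℝ) (hs : ∀ a b, K a b = K b a)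
    (h0 : ∀ a, K a a = 0) (a : ι) :
    ∑ x, ∑ y, K x y = ∑ x ∈ univ.erase a, ∑ y ∈ univ.erase a, K x y + 2 * ∑ y ∈ univ.erase a, K a y := by
  rw [← add_sum_erase univ _ (mem_univ a)]
  rw [← add_sum_erase univ (K a) (mem_univ a), h0]
  have : ∀ x, ∑ y, K x y = K x a + ∑ y ∈ univ.erase a, K x y := fun x =>
    (add_sum_erase univ (K x) (mem_univ a)).symm
  simp only [this, sum_add_distrib]
  have : ∑ x ∈ univ.erase a, K x a = ∑ x ∈ univ.erase a, K a x := sum_congr rfl fun x _ => hs _ _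
  rw [this]; ring

/-- Derandomization by conditional expectations. -/
lemma derand {ι : Type} [Fintype ι] (r : ι → V → ℝ) (hr : ∀ a v, 0 ≤ r a v)
    (O : ι → Set (V → ℝ))
    (hO : ∀ a, ∀ c : V → ℝ, (∀ v, 0 ≤ c v) → ∃ o ∈ O a, (∀ v, 0 ≤ o v) ∧
      ∑ v, o v * c v ≤ ∑ v, r a v * c v)
    (M : ι → ι → ℝ) (hM : ∀ a b, 0 ≤ M a b) (hMs : ∀ a b, M a b = M b a) (hM0 : ∀ a, M a a = 0) :
    ∃ o : ι → V → ℝ, (∀ a, o a ∈ O a) ∧ (∀ a v, 0 ≤ o a v) ∧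
      ∑ a, ∑ b, M a b * ∑ v, o a v * o b v ≤ ∑ a, ∑ b, M a b * ∑ v, r a v * r b v := by
  suffices H : ∀ s : Finset ι, ∃ o : ι → V → ℝ, (∀ a ∈ s, o a ∈ O a) ∧ (∀ a ∉ s, o a = r a) ∧
      (∀ a v, 0 ≤ o a v) ∧
      ∑ a, ∑ b, M a b * ∑ v, o a v * o b v ≤ ∑ a, ∑ b, M a b * ∑ v, r a v * r b v by
    obtain ⟨o, h1, h2, h3, h4⟩ := H univ
    exact ⟨o, fun a => h1 a (mem_univ a), h3, h4⟩
  intro s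
  induction s using Finset.induction_on with
  | empty => exact ⟨r, by simp, by simp, hr, le_rfl⟩
  | insert a s ha ih =>
    obtain ⟨o, h1, h2, h3, h4⟩ := ih
    obtain ⟨t, ht, ht0, htc⟩ := hO a (fun v => ∑ b ∈ univ.erase a, M a b * o b v)
      (fun v => sum_nonneg fun b _ => mul_nonneg (hM _ _) (h3 _ _))
    refine ⟨Function.update o a t, ?_, ?_, ?_, le_trans ?_ h4⟩
    · intro b hb
      by_cases hba : b = a
      · subst hba; simpa using ht
      · rw [Function.update_of_ne hba]; exact h1 b ((mem_insert.1 hb).resolve_left hba)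
    · intro b hb
      rw [mem_insert, not_or] at hb
      rw [Function.update_of_ne hb.1]; exact h2 b hb.2
    · intro b
      by_cases hba : b = a
      · subst hba; simpa using ht0
      · rw [Function.update_of_ne hba]; exact h3 b
    · have sy : ∀ o : ι → V → ℝ, ∀ a b, M a b * ∑ v, o a v * o b v = M b a * ∑ v, o b v * o a v := by
        intro o a b; rw [hMs]; congr 1; exact sum_congr rfl fun v _ => mul_comm _ _
      rw [sum_split (fun x y => M x y * ∑ v, o x v * o y v) (sy o) (by simp [hM0]) a,
        sum_split (fun x y => M x y * ∑ v, Function.update o a t x v * Function.update o a t y v)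
          (sy _) (by simp [hM0]) a]
      have hne : ∀ x ∈ univ.erase a, Function.update o a t x = o x := fun x hx =>
        Function.update_of_ne (ne_of_mem_erase hx) _ _
      refine add_le_add (le_of_eq ?_) (mul_le_mul_of_nonneg_left ?_ (by norm_num))
      · refine sum_congr rfl fun x hx => sum_congr rfl fun y hy => ?_
        rw [hne x hx, hne y hy]
      · have key : ∀ f : V → ℝ, ∑ y ∈ univ.erase a, M a y * ∑ v, f v * o y v =
            ∑ v, f v * ∑ b ∈ univ.erase a, M a b * o b v := by
          intro f
          simp only [mul_sum]
          rw [sum_comm]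
          exact sum_congr rfl fun v _ => sum_congr rfl fun y _ => by ring
        have e : ∑ y ∈ univ.erase a, M a y * ∑ v, Function.update o a t a v * Function.update o a t y v
            = ∑ y ∈ univ.erase a, M a y * ∑ v, t v * o y v := by
          refine sum_congr rfl fun y hy => ?_
          rw [hne y hy]; simp
        rw [e, key, key, h2 a ha]
        exact htc

/-- Rooted connected sets. -/
def RC (G : SimpleGraph V) (Q : Set V) (x : V) : Prop :=
  x ∈ Q ∧ ∀ v ∈ Q, ∃ p : G.Walk x v, ∀ u ∈ p.support, u ∈ Q

/-- A complete minor model. -/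
structure Minor (G : SimpleGraph V) (h : ℕ) where
  B : Fin h → Set V
  root : Fin h → V
  rc : ∀ i, RC G (B i) (root i)
  disj : ∀ i j, i ≠ j → ∀ v, v ∈ B i → v ∉ B j
  edge : ∀ i j, i ≠ j → ∃ a ∈ B i, ∃ b ∈ B j, G.Adj a b

lemma RC.mono_aux {G : SimpleGraph V} {Q Q' : Set V} {x : V} (hQ : RC G Q x) (hs : Q ⊆ Q') :
    ∀ v ∈ Q, ∃ p : G.Walk x v, ∀ u ∈ p.support, u ∈ Q' := by
  intro v hv
  obtain ⟨p, hp⟩ := hQ.2 v hv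
  exact ⟨p, fun u hu => hs (hp u hu)⟩

lemma RC_support {G : SimpleGraph V} {x y : V} (p : G.Walk x y) : RC G {v | v ∈ p.support} x := by
  refine ⟨p.start_mem_support, fun v hv => ⟨p.takeUntil v hv, fun u hu => ?_⟩⟩
  exact p.support_takeUntil_subset_support hv hu

lemma trunc {G : SimpleGraph V} {x y : V} (p : G.Walk x y) (T : Set V) (hy : y ∈ T) (hx : x ∉ T) :
    ∃ Q : Set V, RC G Q x ∧ (∀ v ∈ Q, v ∈ p.support) ∧ (∀ v ∈ Q, v ∉ T) ∧
      ∃ a ∈ Q, ∃ b ∈ T, G.Adj a b := by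
  induction p with
  | nil => exact absurd hy hx
  | @cons x z y hxz p ih =>
    by_cases hz : z ∈ T
    · refine ⟨{x}, ⟨rfl, ?_⟩, ?_, ?_, x, rfl, z, hz, hxz⟩
      · rintro v rfl; exact ⟨SimpleGraph.Walk.nil, by simp⟩
      · rintro v rfl; simp
      · rintro v rfl; exact hx
    · obtain ⟨Q, h1, h2, h3, a, ha, b, hb, hab⟩ := ih hy hz
      refine ⟨insert x Q, ⟨Set.mem_insert _ _, ?_⟩, ?_, ?_, a, Set.mem_insert_of_mem _ ha, b, hb, hab⟩
      · rintro v (rfl | hv)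
        · exact ⟨SimpleGraph.Walk.nil, by simp⟩
        · obtain ⟨q, hq⟩ := h1.2 v hv
          refine ⟨q.cons hxz, fun u hu => ?_⟩
          rw [SimpleGraph.Walk.support_cons, List.mem_cons] at hu
          rcases hu with rfl | hu
          · exact Set.mem_insert _ _
          · exact Set.mem_insert_of_mem _ (hq u hu)
      · rintro v (rfl | hv)
        · simp
        · simp [h2 v hv]
      · rintro v (rfl | hv)
        · exact hx
        · exact h3 v hv

/-- Extraction of a minor from a system of walks. -/
lemma extract {G : SimpleGraph V} {h : ℕ} (hh : 3 ≤ h) (X : Sym2 (Fin h) → V)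
    (P : ∀ i j : Fin h, G.Walk (X s(i,i)) (X s(i,j)))
    (hP : ∀ i j i' j' : Fin h, i ≠ j → i' ≠ j' → i ≠ i' → s(i,j) ≠ s(i',j') →
      ∀ v, v ∈ (P i j).support → v ∉ (P i' j').support) :
    Nonempty (Minor G h) := by
  have hthird : ∀ i j : Fin h, ∃ k : Fin h, k ≠ i ∧ k ≠ j := by
    intro i j
    have : ({i, j} : Finset (Fin h)).card < Fintype.card (Fin h) := by
      have := card_le_two (a := i) (b := j)
      rw [Fintype.card_fin]; omega
    obtain ⟨k, hk⟩ := exists_mem_notMem_of_card_lt_card (s := {i,j}) (t := (univ : Finset (Fin h))) (by simpa using this)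
    exact ⟨k, by have := hk.2; simp at this; exact this⟩
  have hQ : ∀ i j : Fin h, i ≠ j → ∃ Q : Set V, RC G Q (X s(i,i)) ∧ (∀ v ∈ Q, v ∈ (P i j).support) ∧
      (j < i → Q = {v | v ∈ (P i j).support}) ∧
      (i < j → (∀ v ∈ Q, v ∉ (P j i).support) ∧ ∃ a ∈ Q, ∃ b ∈ (P j i).support, G.Adj a b) := by
    intro i j hij
    rcases lt_or_gt_of_ne hij with hlt | hgt
    · obtain ⟨k, hk1, hk2⟩ := hthird i j
      obtain ⟨Q, h1, h2, h3, h4⟩ := trunc (P i j) {v | v ∈ (P j i).support}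
        (by
          have e : X s(i,j) = X s(j,i) := by rw [Sym2.eq_swap]
          show X s(i,j) ∈ (P j i).support
          rw [e]
          exact (P j i).end_mem_support)
        (fun hx => hP i k j i hk1.symm hij.symm hij
          (by intro he; rw [Sym2.eq_iff] at he; rcases he with ⟨a, b⟩ | ⟨a, b⟩
              · exact hij a
              · exact hk2 b) _ (P i k).start_mem_support hx)
      exact ⟨Q, h1, h2, fun h => absurd h (not_lt_of_gt hlt), fun _ => ⟨h3, h4⟩⟩
    · exact ⟨_, RC_support (P i j), fun v hv => hv, fun _ => rfl, fun h => absurd h (not_lt_of_gt hgt)⟩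
  choose! Q hQ1 hQ2 hQ3 hQ4 using hQ
  refine ⟨⟨fun i => {v | ∃ j, i ≠ j ∧ v ∈ Q i j}, fun i => X s(i,i), ?_, ?_, ?_⟩⟩
  · intro i
    refine ⟨?_, ?_⟩
    · obtain ⟨k, hk, _⟩ := hthird i i
      exact ⟨k, hk.symm, (hQ1 i k hk.symm).1⟩
    · rintro v ⟨j, hj, hv⟩
      exact (hQ1 i j hj).mono_aux (Q' := {v | ∃ j, i ≠ j ∧ v ∈ Q i j}) (fun u hu => ⟨j, hj, hu⟩) v hv
  · rintro i i' hii v ⟨j, hj, hv⟩ ⟨j', hj', hv'⟩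
    by_cases hs : s(i,j) = s(i',j')
    · rw [Sym2.eq_iff] at hs
      rcases hs with ⟨a, b⟩ | ⟨a, b⟩
      · exact hii a
      · subst a; subst b
        rcases lt_or_gt_of_ne hii with hlt | hgt
        · exact (hQ4 _ _ hj hlt).1 v hv (hQ2 _ _ hj' v hv')
        · exact (hQ4 _ _ hj' hgt).1 v hv' (hQ2 _ _ hj v hv)
    · exact hP i j i' j' hj hj' hii hs v (hQ2 _ _ hj v hv) (hQ2 _ _ hj' v hv')
  · have key : ∀ i j : Fin h, i < j → ∃ a, (∃ k, i ≠ k ∧ a ∈ Q i k) ∧ ∃ b, (∃ k, j ≠ k ∧ b ∈ Q j k) ∧ G.Adj a b := by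
      intro i j hij
      obtain ⟨_, a, ha, b, hb, hab⟩ := hQ4 i j hij.ne hij
      refine ⟨a, ⟨j, hij.ne, ha⟩, b, ⟨i, hij.ne', ?_⟩, hab⟩
      rw [hQ3 j i hij.ne' hij]; exact hb
    intro i j hij
    rcases lt_or_gt_of_ne hij with hlt | hgt
    · obtain ⟨a, ha, b, hb, hab⟩ := key i j hlt
      exact ⟨a, ha, b, hb, hab⟩
    · obtain ⟨a, ha, b, hb, hab⟩ := key j i hgt
      exact ⟨b, hb, a, ha, hab.symm⟩

lemma single_le_total {ι : Type} [Fintype ι] (K : ι → ι → ℝ) (hK : ∀ a b, 0 ≤ K a b) (a b : ι) :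
    K a b ≤ ∑ x, ∑ y, K x y :=
  (single_le_sum (f := fun y => K a y) (fun y _ => hK a y) (mem_univ b)).trans
    (single_le_sum (f := fun x => ∑ y, K x y) (fun x _ => sum_nonneg fun y _ => hK x y) (mem_univ a))

lemma minor_of_conc {G : SimpleGraph V} (hc : G.Connected) {U : Finset V} (hU : 2 ≤ #U) {Δ h : ℕ}
    (hdeg : ∀ v, #(univ.filter (fun w => G.Adj v w)) ≤ Δ) (hh : 3 ≤ h) {ε : ℝ} (hε : 0 < ε)
    (hsmall : 16000 * (h:ℝ)^8 * Δ * ε < 1)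
    (hC : Conc G U ε) : Nonempty (Minor G h) := by
  obtain ⟨k, o, hk⟩ := exists_green hc
  have hUne : U.Nonempty := card_pos.mp (by omega)
  have hn : (0 : ℝ) < #U := by exact_mod_cast hUne.card_pos
  obtain ⟨γ, hγ⟩ := exists_ker k o hk hUne
  have havg := load_avg hγ hε hC hU hdeg
  set δ0 : ℝ := 4000 * ε * Δ with hδ0
  have hδ00 : 0 ≤ δ0 := by positivity
  set r : V → ℝ := fun v => (∑ x ∈ U, load G γ x v) / #U with hr
  have hr0 : ∀ v, 0 ≤ r v := fun v =>
    div_nonneg (sum_nonneg fun x _ => load_nonneg _ _ _ _) hn.le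
  -- first choice : points
  obtain ⟨o1, ho1, ho1n, ho1s⟩ := derand (ι := Sym2 (Fin h)) (fun _ => r) (fun _ => hr0)
    (fun _ => {f | ∃ x, f = load G γ x})
    (by
      intro _ c hc0
      by_contra hcon
      push Not at hcon
      have h1 : ∀ x ∈ U, ∑ v, r v * c v < ∑ v, load G γ x v * c v := fun x _ =>
        hcon _ ⟨x, rfl⟩ (fun v => load_nonneg _ _ _ _)
      have h2 := sum_lt_sum_of_nonempty hUne h1
      rw [sum_const, nsmul_eq_mul, sum_comm] at h2
      have h3 : ∑ v, ∑ x ∈ U, load G γ x v * c v = #U * ∑ v, r v * c v := by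
        rw [mul_sum]
        refine sum_congr rfl fun v _ => ?_
        rw [← sum_mul]
        simp only [hr]; field_simp
      linarith)
    (fun a b => if a = b then 0 else 1) (fun a b => by split_ifs <;> norm_num)
    (fun a b => by simp [eq_comm]) (fun a => by simp)
  choose X hX using ho1
  have hcardS : (Fintype.card (Sym2 (Fin h)) : ℝ) ≤ (h:ℝ)^2 := by
    have : Fintype.card (Sym2 (Fin h)) ≤ h ^ 2 := by
      have := Fintype.card_le_of_surjective (fun p : Fin h × Fin h => s(p.1, p.2))
        (fun z => by induction z with | _ a b => exact ⟨(a,b), rfl⟩)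
      simpa [sq] using this
    exact_mod_cast this
  have hpair : ∀ a b : Sym2 (Fin h), a ≠ b → ∑ v, load G γ (X a) v * load G γ (X b) v ≤ (h:ℝ)^4 * δ0 := by
    intro a b hab
    have h1 := single_le_total (fun a b => (if a = b then (0:ℝ) else 1) * ∑ v, o1 a v * o1 b v)
      (fun a b => mul_nonneg (by split_ifs <;> norm_num)
        (sum_nonneg fun v _ => mul_nonneg (ho1n _ _) (ho1n _ _))) a b
    have h2 : ∑ a : Sym2 (Fin h), ∑ b : Sym2 (Fin h), (if a = b then (0:ℝ) else 1) * ∑ v, r v * r v ≤ (h:ℝ)^4 * δ0 := by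
      have : ∀ a b : Sym2 (Fin h), (if a = b then (0:ℝ) else 1) * ∑ v, r v * r v ≤ δ0 := by
        intro a b
        have hq : ∑ v, r v * r v = ∑ v, ((∑ x ∈ U, load G γ x v) / (#U:ℝ)) ^ 2 :=
          sum_congr rfl fun v _ => by simp only [hr]; ring
        rw [hq]
        split_ifs
        · simpa using hδ00
        · simpa using havg
      refine (sum_le_sum fun a _ => sum_le_sum fun b _ => this a b).trans ?_
      rw [sum_const, sum_const, smul_smul, nsmul_eq_mul, card_univ]
      push_cast
      refine mul_le_mul_of_nonneg_right ?_ hδ00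
      calc (Fintype.card (Sym2 (Fin h)) : ℝ) * (Fintype.card (Sym2 (Fin h)) : ℝ) ≤ (h:ℝ)^2 * (h:ℝ)^2 := by gcongr
        _ = (h:ℝ)^4 := by ring
    have h3 := h1.trans (ho1s.trans h2)
    simp only [hab, if_false, one_mul, hX] at h3
    exact h3
  set δ : ℝ := (h:ℝ)^4 * δ0 with hδ
  have hδn : 0 ≤ δ := by positivity
  -- second choice : paths
  let conf : Fin h × Fin h → Fin h × Fin h → Prop := fun d e =>
    d.1 ≠ d.2 ∧ e.1 ≠ e.2 ∧ d.1 ≠ e.1 ∧ s(d.1,d.2) ≠ s(e.1,e.2)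
  obtain ⟨o2, ho2, ho2n, ho2s⟩ := derand (ι := Fin h × Fin h)
    (fun d v => load G γ (X s(d.1,d.1)) v + load G γ (X s(d.1,d.2)) v)
    (fun d v => add_nonneg (load_nonneg _ _ _ _) (load_nonneg _ _ _ _))
    (fun d => {f | ∃ p : G.Walk (X s(d.1,d.1)) (X s(d.1,d.2)), f = fun v => if v ∈ p.support then 1 else 0})
    (by
      intro d c hc0
      obtain ⟨p, hp⟩ := path_lemma hc hγ (X s(d.1,d.1)) (X s(d.1,d.2)) c hc0
      refine ⟨_, ⟨p, rfl⟩, fun v => by positivity, le_trans (le_of_eq ?_) hp⟩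
      simp only [ite_mul, one_mul, zero_mul]
      rw [← sum_filter]
      refine sum_congr ?_ fun _ _ => rfl
      ext v; simp)
    (fun d e => if conf d e then 1 else 0) (fun a b => by split_ifs <;> norm_num)
    (fun a b => by
      have : conf a b ↔ conf b a := by
        simp only [conf]
        constructor <;> rintro ⟨x, y, z, w⟩ <;> exact ⟨y, x, z.symm, w.symm⟩
      simp only [this])
    (fun a => by simp [conf])
  choose P hP using ho2
  have htot : ∑ d : Fin h × Fin h, ∑ e : Fin h × Fin h, (if conf d e then (1:ℝ) else 0) *
      ∑ v, (load G γ (X s(d.1,d.1)) v + load G γ (X s(d.1,d.2)) v) *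
        (load G γ (X s(e.1,e.1)) v + load G γ (X s(e.1,e.2)) v) ≤ (h:ℝ)^4 * (4 * δ) := by
    have : ∀ d e : Fin h × Fin h, (if conf d e then (1:ℝ) else 0) *
      ∑ v, (load G γ (X s(d.1,d.1)) v + load G γ (X s(d.1,d.2)) v) *
        (load G γ (X s(e.1,e.1)) v + load G γ (X s(e.1,e.2)) v) ≤ 4 * δ := by
      intro d e
      split_ifs with hde
      · obtain ⟨c1, c2, c3, c4⟩ := hde
        have n1 : s(d.1,d.1) ≠ s(e.1,e.1) := by simpa using c3
        have n2 : s(d.1,d.1) ≠ s(e.1,e.2) := by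
          intro he; rw [Sym2.eq_iff] at he
          rcases he with ⟨a, b⟩ | ⟨a, b⟩ <;> exact c2 (by rw [← a, ← b])
        have n3 : s(d.1,d.2) ≠ s(e.1,e.1) := by
          intro he; rw [Sym2.eq_iff] at he
          rcases he with ⟨a, b⟩ | ⟨a, b⟩ <;> exact c1 (by rw [a, b])
        have b1 := hpair _ _ n1
        have b2 := hpair _ _ n2
        have b3 := hpair _ _ n3
        have b4 := hpair _ _ c4
        simp only [add_mul, mul_add, sum_add_distrib]
        linarith
      · simp; exact hδn
    refine (sum_le_sum fun a _ => sum_le_sum fun b _ => this a b).trans (le_of_eq ?_)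
    rw [sum_const, sum_const, smul_smul, nsmul_eq_mul, card_univ, Fintype.card_prod, Fintype.card_fin]
    push_cast; ring
  have hlt1 : (h:ℝ)^4 * (4 * δ) < 1 := by
    have : (h:ℝ)^4 * (4 * δ) = 16000 * (h:ℝ)^8 * Δ * ε := by simp only [hδ, hδ0]; ring
    rw [this]; exact hsmall
  refine extract hh X (fun i j => P (i,j)) ?_
  intro i j i' j' hij hij' hii hs v hv hv'
  have h1 := single_le_total (fun a b => (if conf a b then (1:ℝ) else 0) * ∑ v, o2 a v * o2 b v)
      (fun a b => mul_nonneg (by split_ifs <;> norm_num)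
        (sum_nonneg fun v _ => mul_nonneg (ho2n _ _) (ho2n _ _))) (i,j) (i',j')
  have h2 : ∑ v, o2 (i,j) v * o2 (i',j') v < 1 := by
    have h3 := (h1.trans (ho2s.trans htot)).trans_lt hlt1
    have hcf : conf (i,j) (i',j') := ⟨hij, hij', hii, hs⟩
    simpa only [hcf, if_true, one_mul] using h3
  have h4 : o2 (i,j) v * o2 (i',j') v ≤ ∑ v, o2 (i,j) v * o2 (i',j') v :=
    single_le_sum (f := fun v => o2 (i,j) v * o2 (i',j') v) (fun u _ => mul_nonneg (ho2n _ _) (ho2n _ _)) (mem_univ v)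
  have h5 : o2 (i,j) v * o2 (i',j') v = 1 := by
    rw [hP (i,j), hP (i',j')]
    have hv1 : v ∈ (P (i,j)).support := hv
    have hv2 : v ∈ (P (i',j')).support := hv'
    simp only [hv1, hv2, if_true, one_mul]
  linarith

end ResAux

namespace ResAux
open CoverTimePaper Finset
open scoped Classical

variable {V : Type} [Fintype V]

/-- Variance functional of a set in the resistance geometry. -/
noncomputable def Phi (G : SimpleGraph V) (k : V → V → ℝ) (U : Finset V) : ℝ :=
  ∑ x ∈ U, bil G (k x) (k x) - (#U : ℝ)⁻¹ * bil G (∑ x ∈ U, k x) (∑ x ∈ U, k x)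

lemma bil_comb (G : SimpleGraph V) (f g : V → ℝ) (a b : ℝ) :
    bil G (a • f - b • g) (a • f - b • g) = a^2 * bil G f f - 2 * a * b * bil G f g + b^2 * bil G g g := by
  rw [bil_sub_left, bil_smul_left, bil_smul_left, bil_comm G f, bil_comm G g, bil_sub_left,
    bil_sub_left, bil_smul_left, bil_smul_left, bil_smul_left, bil_smul_left, bil_comm G g f]
  ring

lemma Phi_split (G : SimpleGraph V) (k : V → V → ℝ) {U A : Finset V} (hA : A ⊆ U) (hAn : A.Nonempty)
    (hBn : (U \ A).Nonempty) :
    Phi G k U = Phi G k A + Phi G k (U \ A) + ((#A : ℝ) * (#(U \ A) : ℝ) / (#U : ℝ)) *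
      bil G (((#A : ℝ)⁻¹) • (∑ x ∈ A, k x) - ((#(U \ A) : ℝ)⁻¹) • (∑ x ∈ U \ A, k x))
        (((#A : ℝ)⁻¹) • (∑ x ∈ A, k x) - ((#(U \ A) : ℝ)⁻¹) • (∑ x ∈ U \ A, k x)) := by
  have ha : (0 : ℝ) < #A := by exact_mod_cast hAn.card_pos
  have hb : (0 : ℝ) < #(U \ A) := by exact_mod_cast hBn.card_pos
  have hab : (#U : ℝ) = #A + #(U \ A) := by
    rw [add_comm]; exact_mod_cast (card_sdiff_add_card_eq_card hA).symm
  rw [bil_comb]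
  unfold Phi
  rw [← sum_sdiff hA, ← sum_sdiff (f := k) hA, hab, bil_add_left, bil_comm G (∑ x ∈ U \ A, k x),
    bil_comm G (∑ x ∈ A, k x) (_ + _), bil_add_left, bil_add_left,
    bil_comm G (∑ x ∈ U \ A, k x) (∑ x ∈ A, k x)]
  generalize (#A : ℝ) = a at *
  generalize (#(U \ A) : ℝ) = b at *
  have : a + b ≠ 0 := by positivity
  field_simp
  ring

lemma Phi_le (G : SimpleGraph V) (k : V → V → ℝ) {U : Finset V} (hU : U.Nonempty) (z : V) :
    Phi G k U ≤ ∑ x ∈ U, bil G (k x - k z) (k x - k z) := by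
  have hn : (0 : ℝ) < #U := by exact_mod_cast hU.card_pos
  have h1 := bil_self_nonneg G ((1:ℝ) • (∑ x ∈ U, k x) - (#U : ℝ) • k z)
  rw [bil_comb] at h1
  have h2 : ∀ x, bil G (k x - k z) (k x - k z) = bil G (k x) (k x) - 2 * bil G (k x) (k z) + bil G (k z) (k z) := by
    intro x
    have := bil_comb G (k x) (k z) 1 1
    simpa using this
  have h3 : ∑ x ∈ U, bil G (k x - k z) (k x - k z) =
      ∑ x ∈ U, bil G (k x) (k x) - 2 * bil G (∑ x ∈ U, k x) (k z) + #U * bil G (k z) (k z) := by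
    simp only [h2, sum_add_distrib, sum_sub_distrib, bil_sum_left, mul_sum, sum_const, nsmul_eq_mul]
  rw [h3]
  unfold Phi
  have h4 : 0 ≤ (#U : ℝ)⁻¹ * (1 ^ 2 * bil G (∑ x ∈ U, k x) (∑ x ∈ U, k x) -
      2 * 1 * (#U : ℝ) * bil G (∑ x ∈ U, k x) (k z) + (#U : ℝ) ^ 2 * bil G (k z) (k z)) :=
    mul_nonneg (by positivity) h1
  have h5 : (#U : ℝ)⁻¹ * (1 ^ 2 * bil G (∑ x ∈ U, k x) (∑ x ∈ U, k x) -
      2 * 1 * (#U : ℝ) * bil G (∑ x ∈ U, k x) (k z) + (#U : ℝ) ^ 2 * bil G (k z) (k z)) =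
      (#U : ℝ)⁻¹ * bil G (∑ x ∈ U, k x) (∑ x ∈ U, k x) - 2 * bil G (∑ x ∈ U, k x) (k z) + #U * bil G (k z) (k z) := by
    field_simp
  linarith

lemma Phi_ge {G : SimpleGraph V} (k : V → V → ℝ) (o : V)
    (hk : ∀ x f, bil G (k x) f = f x - f o) {ε : ℝ}
    (hno : ∀ U : Finset V, 2 ≤ #U → ¬ Conc G U ε) (U : Finset V) :
    ε * (#U * Real.log #U) ≤ Phi G k U := by
  induction U using Finset.strongInduction with
  | H U ih =>
    rcases Nat.lt_or_ge (#U) 2 with hlt | hge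
    · have hz : (#U : ℝ) * Real.log #U = 0 := by
        have : #U = 0 ∨ #U = 1 := by omega
        rcases this with h | h <;> simp [h]
      rw [hz, mul_zero]
      have : #U = 0 ∨ #U = 1 := by omega
      rcases this with h | h
      · rw [card_eq_zero] at h; subst h; simp [Phi, bil_zero_left]
      · rw [card_eq_one] at h; obtain ⟨a, rfl⟩ := h; simp [Phi]
    · have := hno U hge
      unfold Conc at this
      push Not at this
      obtain ⟨A, hA, hAn, hBn, f, hf⟩ := this
      have ha : (0 : ℝ) < #A := by exact_mod_cast hAn.card_pos
      have hb : (0 : ℝ) < #(U \ A) := by exact_mod_cast hBn.card_pos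
      have hab : (#U : ℝ) = #A + #(U \ A) := by
        rw [add_comm]; exact_mod_cast (card_sdiff_add_card_eq_card hA).symm
      have hAss : A ⊂ U := by
        refine ⟨hA, fun h => ?_⟩
        rw [← sdiff_eq_empty_iff_subset] at h
        rw [h] at hBn; exact not_nonempty_empty hBn
      have hBss : U \ A ⊂ U := sdiff_ssubset hA hAn
      rw [Phi_split G k hA hAn hBn]
      set w : V → ℝ := ((#A : ℝ)⁻¹) • (∑ x ∈ A, k x) - ((#(U \ A) : ℝ)⁻¹) • (∑ x ∈ U \ A, k x) with hw
      have hwf : bil G w f = avg A f - avg (U \ A) f := by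
        rw [hw, bil_sub_left, bil_smul_left, bil_smul_left, bil_sum_left, bil_sum_left]
        simp only [hk, sum_sub_distrib, sum_const, nsmul_eq_mul, avg]
        field_simp
        ring
      have hcs := bil_cs G w f
      rw [hwf] at hcs
      have hff := bil_self_nonneg G f
      have hcoef : 0 ≤ ((#A : ℝ) * (#(U \ A) : ℝ) / (#U : ℝ)) := by positivity
      have h1 : ε * ent (#A) (#(U \ A)) * bil G f f < ((#A : ℝ) * (#(U \ A) : ℝ) / (#U : ℝ)) * bil G w w * bil G f f := by
        refine hf.trans_le ?_
        rw [mul_assoc]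
        exact mul_le_mul_of_nonneg_left hcs hcoef
      have h2 : ε * ent (#A) (#(U \ A)) < ((#A : ℝ) * (#(U \ A) : ℝ) / (#U : ℝ)) * bil G w w :=
        lt_of_mul_lt_mul_right h1 hff
      have i1 := ih A hAss
      have i2 := ih (U \ A) hBss
      have e : ε * (#U * Real.log #U) = ε * (#A * Real.log #A) + ε * (#(U \ A) * Real.log #(U \ A)) +
          ε * ent (#A) (#(U \ A)) := by
        unfold ent; rw [hab]; ring
      rw [e]; linarith

lemma main_bound {G : SimpleGraph V} (hc : G.Connected) {ε : ℝ} (hε : 0 < ε)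
    (hno : ∀ U : Finset V, 2 ≤ #U → ¬ Conc G U ε) (W : Finset V) (hW : W.Nonempty) :
    ∃ Z ⊆ W, (#W : ℝ) ^ (1/2 : ℝ) ≤ #Z ∧
      ∀ u ∈ Z, ∀ w ∈ Z, u ≠ w → ε / 2 * Real.log #W ≤ effRes G u w := by
  obtain ⟨k, o, hk⟩ := exists_green hc
  set r : ℝ := ε / 2 * Real.log #W with hr
  have hN : (1 : ℝ) ≤ #W := by exact_mod_cast hW.card_pos
  have hr0 : 0 ≤ r := by
    have := Real.log_nonneg hN
    positivity
  let R : V → V → ℝ := fun x y => bil G (k x - k y) (k x - k y)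
  have hRs : ∀ x y, R x y = R y x := by
    intro x y
    have h1 := bil_comb G (k x) (k y) 1 1
    have h2 := bil_comb G (k y) (k x) 1 1
    simp only [one_smul] at h1 h2
    simp only [R]; rw [h1, h2, bil_comm G (k y) (k x)]; ring
  have hR0 : ∀ x, R x x = 0 := by intro x; simp [R, bil_zero_left]
  let F : Finset (Finset V) := W.powerset.filter (fun Z => ∀ u ∈ Z, ∀ w ∈ Z, u ≠ w → r ≤ R u w)
  have hF : F.Nonempty := ⟨∅, by simp [F]⟩
  obtain ⟨Z, hZ, hZm⟩ := exists_max_image F (fun Z => #Z) hF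
  simp only [F, mem_filter, mem_powerset] at hZ hZm
  obtain ⟨hZW, hZr⟩ := hZ
  refine ⟨Z, hZW, ?_, fun u hu w hw huw => (hZr u hu w hw huw).trans (effRes_ge k o hk u w)⟩
  have hcov : ∀ w ∈ W, ∃ z ∈ Z, R w z ≤ r := by
    intro w hw
    by_cases hwZ : w ∈ Z
    · exact ⟨w, hwZ, by rw [hR0]; exact hr0⟩
    · by_contra hcon
      push Not at hcon
      have := hZm (insert w Z) ⟨insert_subset hw hZW, by
        intro u hu v hv huv
        rw [mem_insert] at hu hv
        rcases hu with rfl | hu <;> rcases hv with rfl | hv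
        · exact absurd rfl huv
        · exact (hcon v hv).le
        · rw [hRs]; exact (hcon u hu).le
        · exact hZr u hu v hv huv⟩
      rw [card_insert_of_notMem hwZ] at this
      omega
  choose! f hfZ hfR using hcov
  have hfib : ∀ z ∈ Z, (#(W.filter (fun w => f w = z)) : ℝ) ≤ (#W : ℝ) ^ (1/2 : ℝ) := by
    intro z hz
    set B := W.filter (fun w => f w = z) with hB
    rcases B.eq_empty_or_nonempty with he | hne
    · rw [he]; simp; positivity
    · have hn : (0 : ℝ) < #B := by exact_mod_cast hne.card_pos
      have h1 := Phi_ge k o hk hno B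
      have h2 := Phi_le G k hne z
      have h3 : ∑ x ∈ B, bil G (k x - k z) (k x - k z) ≤ #B * r := by
        rw [← nsmul_eq_mul, ← sum_const]
        refine sum_le_sum fun x hx => ?_
        rw [hB, mem_filter] at hx
        have := hfR x hx.1
        rw [hx.2] at this; exact this
      have h4 : #B * (ε * Real.log #B) ≤ #B * r := by
        calc _ = ε * (#B * Real.log #B) := by ring
          _ ≤ _ := by linarith
      have h5 := le_of_mul_le_mul_left h4 hn
      have h6 : Real.log #B ≤ Real.log #W * (1/2) := by
        rw [hr] at h5
        have : ε * Real.log #B ≤ ε * (Real.log #W * (1/2)) := by linarith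
        exact le_of_mul_le_mul_left this hε
      rw [Real.rpow_def_of_pos (by linarith), ← Real.log_le_iff_le_exp hn]
      exact h6
  have hsum : (#W : ℝ) ≤ #Z * (#W : ℝ) ^ (1/2 : ℝ) := by
    have h1 := card_eq_sum_card_fiberwise (f := f) (s := W) (t := Z) (fun w hw => hfZ w hw)
    calc (#W : ℝ) = ∑ z ∈ Z, (#(W.filter (fun w => f w = z)) : ℝ) := by
          exact_mod_cast h1
      _ ≤ ∑ z ∈ Z, (#W : ℝ) ^ (1/2 : ℝ) := sum_le_sum hfib
      _ = _ := by rw [sum_const, nsmul_eq_mul]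
  have hpos : 0 < (#W : ℝ) ^ (1/2 : ℝ) := Real.rpow_pos_of_pos (by linarith) _
  have hsq : (#W : ℝ) = (#W : ℝ) ^ (1/2 : ℝ) * (#W : ℝ) ^ (1/2 : ℝ) := by
    rw [← Real.rpow_add (by linarith)]; norm_num
  have h' : (#W : ℝ) ^ (1/2 : ℝ) * (#W : ℝ) ^ (1/2 : ℝ) ≤ #Z * (#W : ℝ) ^ (1/2 : ℝ) := by
    calc _ = (#W:ℝ) := hsq.symm
      _ ≤ #Z * (#W : ℝ) ^ (1/2 : ℝ) := hsum
  exact le_of_mul_le_mul_right h' hpos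

lemma deg_le {G : SimpleGraph V} {Δ : ℕ} (h : maxDeg G = Δ) (v : V) :
    #(univ.filter (fun w => G.Adj v w)) ≤ Δ := by
  have h1 : deg G v ≤ maxDeg G := le_ciSup (f := fun v => deg G v) (Set.finite_range _).bddAbove v
  rw [h] at h1
  refine le_trans (le_of_eq ?_) h1
  unfold deg
  rw [Nat.card_eq_fintype_card, Fintype.card_subtype]

/-- Reduction of the theorem to the absence of large complete minors. -/
lemma assembly (Δ g h : ℕ) (hh : 3 ≤ h) (J : JSSequence Δ g)
    (hmin : ∀ k ≥ 1, IsEmpty (Minor (J.G k) h)) :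
    ∃ A' : ℝ, 0 < A' ∧ ∃ c : ℝ, 0 < c ∧ ∃ K : ℕ, ∀ k ≥ K,
      ∀ W : Finset (J.V k), ∃ Z : Finset (J.V k), Z ⊆ W ∧
        ((W.card : ℝ) ^ c) / ((g : ℝ) + 1) ≤ (Z.card : ℝ) ∧
        ∀ u ∈ Z, ∀ w ∈ Z, u ≠ w →
          (A' / ((Δ : ℝ) * ((g : ℝ) + 1))) * c * Real.log (W.card)
            ≤ effRes (J.G k) u w := by
  set ε : ℝ := 1 / (16000 * (h:ℝ)^8 * Δ + 1) with hεd
  have hε : 0 < ε := by positivity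
  refine ⟨ε, hε, 1/2, by norm_num, 1, fun k hk W => ?_⟩
  rcases W.eq_empty_or_nonempty with rfl | hW
  · refine ⟨∅, subset_rfl, ?_, by simp⟩
    simp
  have hno : ∀ U : Finset (J.V k), 2 ≤ #U → ¬ Conc (J.G k) U ε := by
    intro U hU hC
    have := minor_of_conc (J.conn k) hU (deg_le (J.maxdeg k)) hh hε (by
      rw [hεd, mul_one_div, div_lt_one (by positivity)]; linarith) hC
    exact not_isEmpty_iff.2 this (hmin k hk)
  obtain ⟨Z, hZ, h1, h2⟩ := main_bound (J.conn k) hε hno W hW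
  have hN : (1 : ℝ) ≤ #W := by exact_mod_cast hW.card_pos
  have hlog := Real.log_nonneg hN
  refine ⟨Z, hZ, ?_, ?_⟩
  · refine le_trans ?_ h1
    refine div_le_self (by positivity) ?_
    have : (0:ℝ) ≤ g := by positivity
    linarith
  · intro u hu w hw huw
    refine le_trans ?_ (h2 u hu w hw huw)
    refine mul_le_mul_of_nonneg_right ?_ hlog
    rw [← mul_one_div ε 2]
    refine mul_le_mul_of_nonneg_right ?_ (by norm_num)
    rcases Nat.eq_zero_or_pos Δ with h0 | h0
    · rw [h0]; simp; exact hε.le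
    · refine div_le_self hε.le ?_
      have e1 : (1:ℝ) ≤ Δ := by exact_mod_cast h0
      have e2 : (0:ℝ) ≤ g := by positivity
      nlinarith

end ResAux

namespace ResAux
open CoverTimePaper Finset
open scoped Classical

set_option linter.unusedSectionVars false

variable {V : Type} [Fintype V] {G : SimpleGraph V}

/-- The edge of a dart. -/
def ed (d : G.Dart) : G.edgeSet := ⟨d.edge, d.edge_mem⟩

lemma ed_symm (d : G.Dart) : ed d.symm = ed d := Subtype.ext d.edge_symm

lemma ed_eq_iff (d e : G.Dart) : ed d = ed e ↔ d = e ∨ d = e.symm := by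
  rw [← SimpleGraph.dart_edge_eq_iff]
  exact Subtype.ext_iff

lemma ed_surj (e : G.edgeSet) : ∃ d : G.Dart, ed d = e := by
  obtain ⟨e, he⟩ := e
  induction e with
  | _ a b => exact ⟨⟨(a, b), he⟩, rfl⟩

/-- The faces. -/
abbrev Fa (rs : RotationSystem G) : Type := Quotient (permOrbitSetoid (rs.toPerm * dartRev G))

/-- The face of a dart. -/
def face (rs : RotationSystem G) (d : G.Dart) : Fa rs := Quotient.mk _ d

lemma face_sigma (rs : RotationSystem G) (d : G.Dart) : face rs (rs.toPerm d) = face rs d.symm := by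
  refine (Quotient.sound ?_).symm
  refine ⟨1, ?_⟩
  rw [zpow_one, Equiv.Perm.mul_apply]
  congr 1

lemma face_surj (rs : RotationSystem G) (q : Fa rs) : ∃ d, face rs d = q := Quotient.exists_rep q

/-- Vertex boundary. -/
noncomputable def dV (G : SimpleGraph V) : (G.edgeSet → ZMod 2) →ₗ[ZMod 2] (V → ZMod 2) where
  toFun c := fun v => ∑ d : G.Dart, if d.fst = v then c (ed d) else 0
  map_add' c c' := by
    ext v; simp only [Pi.add_apply, ← sum_add_distrib]
    refine sum_congr rfl fun d _ => by split_ifs <;> simp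
  map_smul' a c := by
    ext v; simp only [Pi.smul_apply, smul_eq_mul, mul_sum, RingHom.id_apply]
    refine sum_congr rfl fun d _ => by split_ifs <;> simp

lemma dV_apply (c : G.edgeSet → ZMod 2) (v : V) :
    dV G c v = ∑ d : G.Dart, if d.fst = v then c (ed d) else 0 := rfl

/-- Face boundary. -/
noncomputable def dF (rs : RotationSystem G) : (Fa rs → ZMod 2) →ₗ[ZMod 2] (G.edgeSet → ZMod 2) where
  toFun S := fun e => S (face rs (Classical.choose (ed_surj e))) +
    S (face rs (Classical.choose (ed_surj e)).symm)
  map_add' c c' := by ext v; simp only [Pi.add_apply]; ring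
  map_smul' a c := by ext v; simp only [Pi.smul_apply, smul_eq_mul, RingHom.id_apply]; ring

lemma dF_apply (rs : RotationSystem G) (S : Fa rs → ZMod 2) (d : G.Dart) :
    dF rs S (ed d) = S (face rs d) + S (face rs d.symm) := by
  have h := Classical.choose_spec (ed_surj (ed d))
  have e : dF rs S (ed d) = S (face rs (Classical.choose (ed_surj (ed d)))) +
    S (face rs (Classical.choose (ed_surj (ed d))).symm) := rfl
  rw [e]
  rcases (ed_eq_iff _ _).1 h with h | h
  · rw [h]
  · rw [h, SimpleGraph.Dart.symm_symm, add_comm]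

lemma z2_add_self (a : ZMod 2) : a + a = 0 := CharTwo.add_self_eq_zero a

lemma z2_eq_of_add (a b : ZMod 2) (h : a + b = 0) : a = b := CharTwo.add_eq_zero.1 h

lemma dV_dF (rs : RotationSystem G) (S : Fa rs → ZMod 2) : dV G (dF rs S) = 0 := by
  ext v
  rw [dV_apply, Pi.zero_apply]
  have h1 : ∀ d : G.Dart, (if d.fst = v then dF rs S (ed d) else 0) =
      (if d.fst = v then S (face rs d) else 0) + (if (rs.toPerm d).fst = v then S (face rs (rs.toPerm d)) else 0) := by
    intro d
    have := rs.fst_eq d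
    rw [dF_apply, face_sigma]
    rw [this]
    split_ifs <;> simp
  simp only [h1, sum_add_distrib]
  rw [Equiv.sum_comp rs.toPerm (fun d => if d.fst = v then S (face rs d) else 0)]
  exact z2_add_self _

lemma rot_const (rs : RotationSystem G) {T : G.Dart → ZMod 2} (h : ∀ d, T (rs.toPerm d) = T d)
    (d d' : G.Dart) (hd : d.fst = d'.fst) : T d = T d' := by
  obtain ⟨n, hn⟩ := rs.cyclic d d' hd
  rw [← hn]
  clear hn
  induction n with
  | zero => rfl
  | succ n ih => rw [pow_succ', Equiv.Perm.mul_apply, h, ih]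

lemma walk_const (rs : RotationSystem G) {T : G.Dart → ZMod 2} (h : ∀ d, T (rs.toPerm d) = T d)
    (h' : ∀ d, T d.symm = T d) {u v : V} (p : G.Walk u v) :
    ∀ d d' : G.Dart, d.fst = u → d'.fst = v → T d = T d' := by
  induction p with
  | nil => intro d d' hd hd'; exact rot_const rs h d d' (hd.trans hd'.symm)
  | @cons u w v huw p ih =>
    intro d d' hd hd'
    have h1 := rot_const rs h d ⟨(u, w), huw⟩ hd
    rw [h1, ← h']
    exact ih _ d' rfl hd'

lemma dF_ker (hc : G.Connected) (rs : RotationSystem G) {S : Fa rs → ZMod 2} (h : dF rs S = 0) :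
    ∀ a b, S a = S b := by
  have h1 : ∀ d, S (face rs d.symm) = S (face rs d) := by
    intro d
    have := congrFun h (ed d)
    rw [dF_apply, Pi.zero_apply] at this
    exact (z2_eq_of_add _ _ this).symm
  intro a b
  obtain ⟨d, rfl⟩ := face_surj rs a
  obtain ⟨d', rfl⟩ := face_surj rs b
  obtain ⟨p⟩ := hc.preconnected d.fst d'.fst
  exact walk_const rs (T := fun d => S (face rs d)) (fun d => by simp only [face_sigma, h1]) h1 p d d' rfl rfl

lemma span1_le {M : Type} [AddCommGroup M] [Module (ZMod 2) M] (x : M) :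
    Module.finrank (ZMod 2) (Submodule.span (ZMod 2) {x}) ≤ 1 :=
  (finrank_span_le_card _).trans (by simp)

lemma finrank_dF (hc : G.Connected) (rs : RotationSystem G) :
    Fintype.card (Fa rs) ≤ Module.finrank (ZMod 2) (LinearMap.range (dF rs)) + 1 := by
  have h1 := LinearMap.finrank_range_add_finrank_ker (dF rs)
  rw [Module.finrank_fintype_fun_eq_card] at h1
  have h2 : Module.finrank (ZMod 2) (LinearMap.ker (dF rs)) ≤ 1 := by
    have hle : LinearMap.ker (dF rs) ≤ Submodule.span (ZMod 2) {(fun _ => 1 : Fa rs → ZMod 2)} := by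
      intro S hS
      rw [LinearMap.mem_ker] at hS
      have := dF_ker hc rs hS
      rw [Submodule.mem_span_singleton]
      by_cases hne : Nonempty (Fa rs)
      · obtain ⟨a⟩ := hne
        exact ⟨S a, by ext b; simp [this a b]⟩
      · exact ⟨0, by ext b; exact absurd ⟨b⟩ hne⟩
    exact (Submodule.finrank_mono hle).trans (span1_le _)
  omega

lemma dV_single (d : G.Dart) :
    dV G (Pi.single (ed d) 1) = Pi.single d.fst 1 + Pi.single d.snd 1 := by
  ext v
  rw [dV_apply]
  have hne : d ≠ d.symm := (SimpleGraph.Dart.symm_ne d).symm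
  have h1 : ∀ e : G.Dart, (if e.fst = v then (Pi.single (ed d) 1 : G.edgeSet → ZMod 2) (ed e) else 0) =
      (if e = d then (if d.fst = v then 1 else 0) else 0) + (if e = d.symm then (if d.snd = v then 1 else 0) else 0) := by
    intro e
    simp only [Pi.single_apply, ed_eq_iff]
    by_cases h1 : e = d
    · subst h1; simp [hne]
    · by_cases h2 : e = d.symm
      · subst h2; simp [hne.symm]
      · simp [h1, h2]
  simp only [h1, sum_add_distrib]
  simp [Pi.single_apply, eq_comm]

/-- A walk gives a chain. -/
lemma walk_chain {u v : V} (p : G.Walk u v) : ∃ c : G.edgeSet → ZMod 2,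
    dV G c = Pi.single u 1 + Pi.single v 1 ∧
    ∀ d : G.Dart, c (ed d) ≠ 0 → d.fst ∈ p.support ∧ d.snd ∈ p.support := by
  induction p with
  | nil => exact ⟨0, by rw [map_zero]; ext w; simp [z2_add_self], by simp⟩
  | @cons u w v huw p ih =>
    obtain ⟨c, h1, h2⟩ := ih
    refine ⟨Pi.single (ed ⟨(u, w), huw⟩) 1 + c, ?_, ?_⟩
    · rw [map_add, h1, dV_single]
      have : (Pi.single w 1 + Pi.single w 1 : V → ZMod 2) = 0 := by ext x; exact z2_add_self _
      calc _ = Pi.single u 1 + (Pi.single w 1 + Pi.single w 1 : V → ZMod 2) + Pi.single v 1 := by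
            abel
        _ = _ := by rw [this, add_zero]
    · intro d hd
      rw [SimpleGraph.Walk.support_cons]
      by_cases hde : ed d = ed ⟨(u, w), huw⟩
      · rcases (ed_eq_iff _ _).1 hde with rfl | rfl
        · simp
        · simp [SimpleGraph.Dart.symm]
      · have : c (ed d) ≠ 0 := by
          rw [Pi.add_apply, Pi.single_apply, if_neg hde, zero_add] at hd; exact hd
        have := h2 d this
        exact ⟨List.mem_cons_of_mem _ this.1, List.mem_cons_of_mem _ this.2⟩

lemma finrank_dV (hc : G.Connected) :
    Module.finrank (ZMod 2) (LinearMap.ker (dV G)) + Fintype.card V ≤ Fintype.card G.edgeSet + 1 := by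
  have h1 := LinearMap.finrank_range_add_finrank_ker (dV G)
  rw [Module.finrank_fintype_fun_eq_card] at h1
  obtain ⟨o⟩ := hc.nonempty
  have h2 : LinearMap.range (dV G) ⊔ Submodule.span (ZMod 2) {(Pi.single o 1 : V → ZMod 2)} = ⊤ := by
    rw [eq_top_iff, ← (Pi.basisFun (ZMod 2) V).span_eq, Submodule.span_le]
    rintro _ ⟨v, rfl⟩
    rw [Pi.basisFun_apply]
    obtain ⟨p⟩ := hc.preconnected v o
    obtain ⟨c, hc1, _⟩ := walk_chain p
    have : (Pi.single v 1 : V → ZMod 2) = dV G c + Pi.single o 1 := by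
      rw [hc1, add_assoc]
      have : (Pi.single o 1 + Pi.single o 1 : V → ZMod 2) = 0 := by ext x; exact z2_add_self _
      rw [this, add_zero]
    rw [this]
    exact Submodule.add_mem_sup ⟨c, rfl⟩ (Submodule.mem_span_singleton_self _)
  have h3 := Submodule.finrank_add_le_finrank_add_finrank (LinearMap.range (dV G))
    (Submodule.span (ZMod 2) {(Pi.single o 1 : V → ZMod 2)})
  rw [h2, finrank_top, Module.finrank_fintype_fun_eq_card] at h3
  have h4 := span1_le (Pi.single o 1 : V → ZMod 2)
  omega

lemma range_le_ker (rs : RotationSystem G) : LinearMap.range (dF rs) ≤ LinearMap.ker (dV G) := by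
  rintro _ ⟨S, rfl⟩
  exact dV_dF rs S

lemma euler_le (hc : G.Connected) (rs : RotationSystem G) :
    (Nat.card V : ℤ) - (numEdges G : ℤ) + (numFaces rs : ℤ) ≤ 2 := by
  have h1 := finrank_dF hc rs
  have h2 := finrank_dV hc
  have h3 := Submodule.finrank_mono (range_le_ker rs)
  have h4 : numEdges G = Fintype.card G.edgeSet := Nat.card_eq_fintype_card
  have h5 : numFaces rs = Fintype.card (Fa rs) := Nat.card_eq_fintype_card
  rw [h4, h5, Nat.card_eq_fintype_card]
  omega

lemma codim_le (hc : G.Connected) (rs : RotationSystem G) (g : ℕ)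
    (hE : (Nat.card V : ℤ) - (numEdges G : ℤ) + (numFaces rs : ℤ) = 2 - 2 * (g : ℤ)) :
    Module.finrank (ZMod 2) (LinearMap.ker (dV G)) ≤
      Module.finrank (ZMod 2) (LinearMap.range (dF rs)) + 2 * g := by
  have h1 := finrank_dF hc rs
  have h2 := finrank_dV hc
  have h4 : numEdges G = Fintype.card G.edgeSet := Nat.card_eq_fintype_card
  have h5 : numFaces rs = Fintype.card (Fa rs) := Nat.card_eq_fintype_card
  rw [h4, h5, Nat.card_eq_fintype_card] at hE
  omega

end ResAux

namespace ResAux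
open CoverTimePaper Finset
open scoped Classical

set_option linter.unusedSectionVars false

variable {V : Type} [Fintype V] {G : SimpleGraph V}

lemma numOrbits_eq {α : Type} [Fintype α] [DecidableEq α] (φ : Equiv.Perm α) :
    numOrbits φ = #φ.cycleFactorsFinset + #(φ.supportᶜ) := by
  let m : α → Equiv.Perm α ⊕ α := fun x => if x ∈ φ.support then Sum.inl (φ.cycleOf x) else Sum.inr x
  have hm : ∀ x y, m x = m y ↔ φ.SameCycle x y := by
    intro x y
    simp only [m]
    constructor
    · split_ifs with hx hy hy
      · intro h
        have h := Sum.inl.inj h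
        by_contra hns
        have h1 := Equiv.Perm.cycleOf_apply_of_not_sameCycle hns
        rw [h, Equiv.Perm.cycleOf_apply_self] at h1
        exact Equiv.Perm.mem_support.1 hy h1
      · intro h; cases h
      · intro h; cases h
      · intro h; rw [Sum.inr.inj h]
    · intro h
      have hs : x ∈ φ.support ↔ y ∈ φ.support := by
        rw [Equiv.Perm.mem_support, Equiv.Perm.mem_support, not_iff_not]
        exact h.apply_eq_self_iff
      by_cases hx : x ∈ φ.support
      · rw [if_pos hx, if_pos (hs.1 hx), h.cycleOf_eq]
      · rw [if_neg hx, if_neg (fun hy => hx (hs.2 hy))]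
        congr 1
        obtain ⟨n, hn⟩ := h
        rw [Equiv.Perm.notMem_support] at hx
        rw [← hn, Equiv.Perm.zpow_apply_eq_self_of_apply_eq_self hx]
  let M : Quotient (permOrbitSetoid φ) → Equiv.Perm α ⊕ α :=
    Quotient.lift m (fun x y h => (hm x y).2 h)
  have hM : Function.Injective M := by
    intro a b hab
    induction a using Quotient.inductionOn with | _ a => ?_
    induction b using Quotient.inductionOn with | _ b => ?_
    exact Quotient.sound ((hm a b).1 hab)
  have himg : univ.image M = φ.cycleFactorsFinset.disjSum (φ.supportᶜ) := by
    ext z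
    rw [mem_image]
    constructor
    · rintro ⟨q, _, rfl⟩
      induction q using Quotient.inductionOn with | _ x => ?_
      show m x ∈ _
      simp only [m]
      split_ifs with hx
      · rw [inl_mem_disjSum]; exact Equiv.Perm.cycleOf_mem_cycleFactorsFinset_iff.2 hx
      · rw [inr_mem_disjSum, mem_compl]; exact hx
    · intro hz
      rcases z with p | x
      · rw [inl_mem_disjSum, Equiv.Perm.mem_cycleFactorsFinset_iff] at hz
        have hp : p ∈ φ.cycleFactorsFinset := Equiv.Perm.mem_cycleFactorsFinset_iff.2 hz
        obtain ⟨x, hx, _⟩ := hz.1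
        refine ⟨Quotient.mk _ x, mem_univ _, ?_⟩
        show m x = _
        have hxp : x ∈ p.support := Equiv.Perm.mem_support.2 hx
        have hxs : x ∈ φ.support := by
          rw [Equiv.Perm.mem_support, ← hz.2 x hxp]; exact hx
        simp only [m]
        rw [if_pos hxs, Equiv.Perm.cycle_is_cycleOf hxp hp]
      · rw [inr_mem_disjSum, mem_compl] at hz
        exact ⟨Quotient.mk _ x, mem_univ _, if_neg hz⟩
  rw [← card_disjSum, ← himg, card_image_of_injective _ hM, card_univ]
  exact Nat.card_eq_fintype_card

lemma sign_eq {α : Type} [Fintype α] [DecidableEq α] (φ : Equiv.Perm α) :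
    Equiv.Perm.sign φ = (-1 : ℤˣ) ^ (Fintype.card α + numOrbits φ) := by
  rw [Equiv.Perm.sign_of_cycleType, numOrbits_eq, Equiv.Perm.sum_cycleType]
  have h1 : Multiset.card φ.cycleType = #φ.cycleFactorsFinset := by
    rw [Equiv.Perm.cycleType_def, Multiset.card_map]; rfl
  have h2 : Fintype.card α = #φ.support + #(φ.supportᶜ) := (card_add_card_compl _).symm
  rw [h1, h2]
  have : #φ.support + #(φ.supportᶜ) + (#φ.cycleFactorsFinset + #(φ.supportᶜ)) =
    #φ.support + #φ.cycleFactorsFinset + 2 * #(φ.supportᶜ) := by ring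
  rw [this, pow_add _ _ (2 * _), pow_mul]
  simp

lemma exists_dart (hc : G.Connected) (hV : 2 ≤ Nat.card V) (v : V) : ∃ d : G.Dart, d.fst = v := by
  have : Nontrivial V := by
    rw [Nat.card_eq_fintype_card] at hV
    exact Fintype.one_lt_card_iff_nontrivial.1 hV
  obtain ⟨w, hw⟩ := hc.preconnected.exists_adj_of_nontrivial v
  exact ⟨⟨(v, w), hw⟩, rfl⟩

lemma orbits_sigma (hc : G.Connected) (hV : 2 ≤ Nat.card V) (rs : RotationSystem G) :
    numOrbits rs.toPerm = Nat.card V := by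
  have hz : ∀ (n : ℕ) (d : G.Dart), ((rs.toPerm ^ n) d).fst = d.fst := by
    intro n d
    induction n with
    | zero => rfl
    | succ n ih => rw [pow_succ', Equiv.Perm.mul_apply]; exact (rs.fst_eq _).trans ih
  refine Nat.card_congr (Equiv.ofBijective (Quotient.lift (fun d : G.Dart => d.fst) ?_) ⟨?_, ?_⟩)
  · rintro a b ⟨n, rfl⟩
    show a.fst = _
    obtain ⟨m, rfl | rfl⟩ := n.eq_nat_or_neg
    · rw [zpow_natCast, hz]
    · rw [zpow_neg, zpow_natCast]
      have := hz m ((rs.toPerm ^ m)⁻¹ a)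
      rw [← Equiv.Perm.mul_apply, mul_inv_cancel, Equiv.Perm.one_apply] at this
      exact this
  · intro a b hab
    induction a using Quotient.inductionOn with | _ a => ?_
    induction b using Quotient.inductionOn with | _ b => ?_
    obtain ⟨n, hn⟩ := rs.cyclic a b hab
    exact Quotient.sound ⟨n, by rw [zpow_natCast]; exact hn⟩
  · intro v
    obtain ⟨d, hd⟩ := exists_dart hc hV v
    exact ⟨Quotient.mk _ d, hd⟩

lemma orbits_alpha : numOrbits (dartRev G) = numEdges G := by
  have h1 : ∀ d : G.Dart, ed (dartRev G d) = ed d := fun d => ed_symm d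
  have h2 : (dartRev G)⁻¹ = dartRev G := rfl
  have hz : ∀ (n : ℕ) (d : G.Dart), ed ((dartRev G ^ n) d) = ed d := by
    intro n d
    induction n with
    | zero => rfl
    | succ n ih => rw [pow_succ', Equiv.Perm.mul_apply, h1, ih]
  refine Nat.card_congr (Equiv.ofBijective (Quotient.lift (fun d : G.Dart => ed d) ?_) ⟨?_, ?_⟩)
  · rintro a b ⟨n, rfl⟩
    show ed a = _
    obtain ⟨m, rfl | rfl⟩ := n.eq_nat_or_neg
    · rw [zpow_natCast, hz]
    · rw [zpow_neg, ← inv_zpow, h2, zpow_natCast, hz]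
  · intro a b hab
    induction a using Quotient.inductionOn with | _ a => ?_
    induction b using Quotient.inductionOn with | _ b => ?_
    rcases (ed_eq_iff a b).1 hab with rfl | rfl
    · rfl
    · exact Quotient.sound ⟨1, by rw [zpow_one]; exact b.symm_symm⟩
  · intro e
    obtain ⟨d, hd⟩ := ed_surj e
    exact ⟨Quotient.mk _ d, hd⟩

lemma parity (hc : G.Connected) (hV : 2 ≤ Nat.card V) (rs : RotationSystem G) :
    Even (Nat.card V + numEdges G + numFaces rs) := by
  have h1 := sign_eq (rs.toPerm * dartRev G)
  rw [Equiv.Perm.sign_mul, sign_eq, sign_eq, orbits_sigma hc hV, orbits_alpha] at h1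
  have hD : Fintype.card G.Dart = 2 * numEdges G := by
    rw [SimpleGraph.dart_card_eq_twice_card_edges, SimpleGraph.edgeFinset_card]
    unfold numEdges; rw [Nat.card_eq_fintype_card]
  change _ = (-1 : ℤˣ) ^ (Fintype.card G.Dart + numFaces rs) at h1
  rw [hD] at h1
  simp only [pow_add, pow_mul] at h1
  simp only [Int.units_sq, one_pow, one_mul] at h1
  have h2 : (-1 : ℤˣ) ^ (Nat.card V + numEdges G + numFaces rs) = 1 := by
    rw [pow_add, pow_add, h1, ← pow_add, ← two_mul, pow_mul]; simp
  by_contra hodd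
  rw [Nat.not_even_iff_odd] at hodd
  rw [hodd.neg_one_pow] at h2
  exact absurd h2 (by decide)

lemma exists_rot (G : SimpleGraph V) : Nonempty (RotationSystem G) := by
  have h := fun v : V => exists_cycleOn (univ.filter (fun d : G.Dart => d.fst = v))
  choose f hf _ using h
  have hfst : ∀ d : G.Dart, (f d.fst d).fst = d.fst := by
    intro d
    have : d ∈ (↑(univ.filter (fun e : G.Dart => e.fst = d.fst)) : Set G.Dart) := by simp
    have := (hf d.fst).1.mapsTo this
    simpa using this
  have hinj : Function.Injective (fun d : G.Dart => f d.fst d) := by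
    intro a b hab
    have h1 : f a.fst a = f b.fst b := hab
    have h2 : a.fst = b.fst := by rw [← hfst a, ← hfst b, h1]
    rw [h2] at h1
    exact (f b.fst).injective h1
  let σ : Equiv.Perm G.Dart := Equiv.ofBijective _ (Finite.injective_iff_bijective.1 hinj)
  have hσ : ∀ d, σ d = f d.fst d := fun d => rfl
  have hpow : ∀ (n : ℕ) (d : G.Dart), (σ ^ n) d = (f d.fst ^ n) d ∧ ((σ ^ n) d).fst = d.fst := by
    intro n d
    induction n with
    | zero => exact ⟨rfl, rfl⟩
    | succ n ih =>
      rw [pow_succ', pow_succ', Equiv.Perm.mul_apply, Equiv.Perm.mul_apply, hσ, hfst, ih.2]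
      exact ⟨by rw [ih.1], rfl⟩
  refine ⟨⟨σ, hfst, fun d d' hdd => ?_⟩⟩
  obtain ⟨n, _, hn⟩ := (hf d.fst).exists_pow_eq (a := d) (b := d') (by simp)
    (by simp only [mem_filter, mem_univ, true_and]; exact hdd.symm)
  exact ⟨n, by rw [(hpow n d).1]; exact hn⟩

lemma genus_attained (hc : G.Connected) (hV : 2 ≤ Nat.card V) {g : ℕ} (hg : minGenus G = g) :
    ∃ rs : RotationSystem G,
      (Nat.card V : ℤ) - (numEdges G : ℤ) + (numFaces rs : ℤ) = 2 - 2 * (g : ℤ) := by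
  subst hg
  refine Nat.sInf_mem (s := {g : ℕ | ∃ rs : RotationSystem G,
    (Nat.card V : ℤ) - (numEdges G : ℤ) + (numFaces rs : ℤ) = 2 - 2 * (g : ℤ)}) ?_
  obtain ⟨rs⟩ := exists_rot G
  have h1 := euler_le hc rs
  obtain ⟨m, hm⟩ := parity hc hV rs
  refine ⟨((2 - ((Nat.card V : ℤ) - (numEdges G : ℤ) + (numFaces rs : ℤ))) / 2).toNat, rs, ?_⟩
  omega

end ResAux

namespace ResAux
open CoverTimePaper Finset
open scoped Classical

set_option linter.unusedSectionVars false

variable {V : Type} [Fintype V] {G : SimpleGraph V}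

/-- Ordered pairs. -/
abbrev Pr (n : ℕ) : Type := {p : Fin n × Fin n // p.1 < p.2}

lemma card_Pr (n : ℕ) : 2 * Fintype.card (Pr n) + n = n * n := by
  have h0 : Fintype.card (Pr n) = #(univ.filter (fun p : Fin n × Fin n => p.1 < p.2)) :=
    Fintype.card_subtype _
  have h1 : #(univ.filter (fun p : Fin n × Fin n => p.2 < p.1)) =
      #(univ.filter (fun p : Fin n × Fin n => p.1 < p.2)) := by
    refine card_bij (fun p _ => p.swap) ?_ ?_ ?_
    · intro p hp; simpa using hp
    · intro p _ q _ h; exact Prod.swap_injective h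
    · intro p hp; exact ⟨p.swap, by simpa using hp, by simp⟩
  have h2 : #(univ.filter (fun p : Fin n × Fin n => p.1 = p.2)) = n := by
    have : univ.filter (fun p : Fin n × Fin n => p.1 = p.2) = (univ : Finset (Fin n)).image (fun i => (i, i)) := by
      ext ⟨a, b⟩; simp
    rw [this, card_image_of_injective _ (fun a b h => (Prod.ext_iff.1 h).1)]
    simp
  have h3 : ∀ p : Fin n × Fin n, 1 = (if p.1 < p.2 then 1 else 0) + (if p.2 < p.1 then 1 else 0) +
      (if p.1 = p.2 then 1 else 0) := by
    intro p
    rcases lt_trichotomy p.1 p.2 with h | h | h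
    · simp [h, h.ne, h.not_gt]
    · simp [h]
    · simp [h, h.ne', h.not_gt]
  have h4 : ∑ p : Fin n × Fin n, 1 = n * n := by simp
  rw [sum_congr rfl (fun p _ => h3 p)] at h4
  simp only [sum_add_distrib, ← card_filter] at h4
  omega

section Count

variable {h : ℕ} (B : Fin h → Set V) (conn : Pr h → G.Dart)

/-- Allowed darts. -/
def Alw (d : G.Dart) : Prop :=
  (∃ i, d.fst ∈ B i ∧ d.snd ∈ B i) ∨ ∃ p, ed d = ed (conn p)

/-- Cycles supported on allowed edges. -/
def CA : Submodule (ZMod 2) (G.edgeSet → ZMod 2) where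
  carrier := {c | dV G c = 0 ∧ ∀ d, c (ed d) ≠ 0 → Alw B conn d}
  add_mem' := by
    rintro a b ⟨ha, ha'⟩ ⟨hb, hb'⟩
    refine ⟨by rw [map_add, ha, hb, add_zero], fun d hd => ?_⟩
    by_cases h1 : a (ed d) = 0
    · refine hb' d (fun h2 => hd ?_)
      rw [Pi.add_apply, h1, h2, add_zero]
    · exact ha' d h1
  zero_mem' := ⟨map_zero _, fun d hd => absurd rfl hd⟩
  smul_mem' := by
    rintro r a ⟨ha, ha'⟩
    refine ⟨by rw [map_smul, ha, smul_zero], fun d hd => ha' d (fun h1 => hd ?_)⟩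
    rw [Pi.smul_apply, h1, smul_zero]

/-- Endpoint of a pair. -/
def Inc (i : Fin h) (p : Pr h) : Prop := i = p.1.1 ∨ i = p.1.2

variable {B conn}

lemma B_unique (hdisj : ∀ i j, i ≠ j → ∀ v, v ∈ B i → v ∉ B j) {i j : Fin h} {v : V}
    (h1 : v ∈ B i) (h2 : v ∈ B j) : i = j := by
  by_contra hne; exact hdisj i j hne v h1 h2

lemma conn_inj (hdisj : ∀ i j, i ≠ j → ∀ v, v ∈ B i → v ∉ B j)
    (hconn : ∀ p, (conn p).fst ∈ B p.1.1 ∧ (conn p).snd ∈ B p.1.2)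
    {p q : Pr h} (he : ed (conn p) = ed (conn q)) : p = q := by
  rcases (ed_eq_iff _ _).1 he with h1 | h1
  · have a := hconn p
    rw [h1] at a
    exact Subtype.ext (Prod.ext (B_unique hdisj a.1 (hconn q).1) (B_unique hdisj a.2 (hconn q).2))
  · have a := hconn p
    rw [h1] at a
    have e1 : p.1.1 = q.1.2 := B_unique hdisj a.1 (hconn q).2
    have e2 : p.1.2 = q.1.1 := B_unique hdisj a.2 (hconn q).1
    have l1 := p.2
    have l2 := q.2
    rw [e1, e2] at l1
    exact absurd l1 (not_lt_of_gt l2)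

lemma deg_step (hdisj : ∀ i j, i ≠ j → ∀ v, v ∈ B i → v ∉ B j)
    (hconn : ∀ p, (conn p).fst ∈ B p.1.1 ∧ (conn p).snd ∈ B p.1.2)
    {c : G.edgeSet → ZMod 2} (hc : c ∈ CA B conn) {p : Pr h} (hp : c (ed (conn p)) ≠ 0)
    {i : Fin h} (hi : Inc i p) : ∃ q, q ≠ p ∧ c (ed (conn q)) ≠ 0 ∧ Inc i q := by
  have hpl := p.2
  -- the dart of `p` leaving `B i`
  obtain ⟨d0, hd0, hd0f, hd0s⟩ : ∃ d0 : G.Dart, ed d0 = ed (conn p) ∧ d0.fst ∈ B i ∧ d0.snd ∉ B i := by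
    rcases hi with hi | hi
    · refine ⟨conn p, rfl, hi ▸ (hconn p).1, fun hs => ?_⟩
      have := B_unique hdisj hs (hconn p).2
      exact hpl.ne (hi ▸ this)
    · refine ⟨(conn p).symm, ed_symm _, hi ▸ (hconn p).2, fun hs => ?_⟩
      have := B_unique hdisj hs (hconn p).1
      exact hpl.ne (hi ▸ this.symm)
  have h1 : ∑ v ∈ univ.filter (fun v => v ∈ B i), dV G c v = 0 := by
    rw [hc.1]; simp
  have h2 : ∑ v ∈ univ.filter (fun v => v ∈ B i), dV G c v =
      ∑ d ∈ univ.filter (fun d : G.Dart => d.fst ∈ B i), c (ed d) := by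
    simp only [dV_apply]
    rw [sum_comm, sum_filter]
    refine sum_congr rfl fun d _ => ?_
    rw [sum_ite_eq]
    simp
  have h3 : ∑ d ∈ univ.filter (fun d : G.Dart => d.fst ∈ B i), c (ed d) =
      ∑ d ∈ univ.filter (fun d : G.Dart => d.fst ∈ B i ∧ d.snd ∈ B i), c (ed d) +
      ∑ d ∈ univ.filter (fun d : G.Dart => d.fst ∈ B i ∧ d.snd ∉ B i), c (ed d) := by
    rw [← sum_filter_add_sum_filter_not _ (fun d : G.Dart => d.snd ∈ B i), filter_filter, filter_filter]
  have h4 : ∑ d ∈ univ.filter (fun d : G.Dart => d.fst ∈ B i ∧ d.snd ∈ B i), c (ed d) = 0 := by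
    refine sum_involution (fun d _ => d.symm) ?_ ?_ ?_ ?_
    · intro d _; rw [ed_symm]; exact z2_add_self _
    · intro d _ _; exact SimpleGraph.Dart.symm_ne d
    · intro d hd; simp only [mem_filter, mem_univ, true_and] at hd ⊢; exact ⟨hd.2, hd.1⟩
    · intro d _; exact d.symm_symm
  rw [h2, h3, h4, zero_add] at h1
  obtain ⟨d1, hd1f, hd1s, hne, hd1c⟩ : ∃ d1 : G.Dart, d1.fst ∈ B i ∧ d1.snd ∉ B i ∧ d1 ≠ d0 ∧ c (ed d1) ≠ 0 := by
    by_contra hcon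
    push Not at hcon
    rw [sum_eq_single d0] at h1
    · rw [hd0] at h1; exact hp h1
    · intro d hd hne
      simp only [mem_filter, mem_univ, true_and] at hd
      exact hcon d hd.1 hd.2 hne
    · intro hd
      exact absurd (by simp only [mem_filter, mem_univ, true_and]; exact ⟨hd0f, hd0s⟩) hd
  rcases hc.2 d1 hd1c with ⟨j, hj1, hj2⟩ | ⟨q, hq⟩
  · rw [B_unique hdisj hj1 hd1f] at hj2; exact absurd hj2 hd1s
  · refine ⟨q, ?_, hq ▸ hd1c, ?_⟩
    · rintro rfl
      rcases (ed_eq_iff _ _).1 (hq.trans hd0.symm) with e | e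
      · exact hne e
      · rw [e] at hd1f; exact hd0s hd1f
    · rcases (ed_eq_iff _ _).1 hq with e | e
      · rw [e] at hd1f; exact Or.inl (B_unique hdisj hd1f (hconn q).1)
      · rw [e] at hd1f; exact Or.inr (B_unique hdisj hd1f (hconn q).2)

lemma three_le (hdisj : ∀ i j, i ≠ j → ∀ v, v ∈ B i → v ∉ B j)
    (hconn : ∀ p, (conn p).fst ∈ B p.1.1 ∧ (conn p).snd ∈ B p.1.2)
    {c : G.edgeSet → ZMod 2} (hc : c ∈ CA B conn) {p : Pr h} (hp : c (ed (conn p)) ≠ 0) :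
    3 ≤ #(univ.filter (fun q => c (ed (conn q)) ≠ 0)) := by
  obtain ⟨q, hq, hqc, hqi⟩ := deg_step hdisj hconn hc hp (i := p.1.1) (Or.inl rfl)
  obtain ⟨r, hr, hrc, hri⟩ := deg_step hdisj hconn hc hp (i := p.1.2) (Or.inr rfl)
  have hqr : q ≠ r := by
    rintro rfl
    have l1 := p.2
    have l2 := q.2
    apply hq
    rcases hqi with a | a <;> rcases hri with b | b
    · exact absurd (a.trans b.symm) l1.ne
    · exact Subtype.ext (Prod.ext a.symm b.symm)
    · rw [a, b] at l1; exact absurd l1 (not_lt_of_gt l2)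
    · exact absurd (a.trans b.symm) l1.ne
  have hs : ({p, q, r} : Finset (Pr h)) ⊆ univ.filter (fun q => c (ed (conn q)) ≠ 0) := by
    intro x hx
    simp only [mem_insert, mem_singleton] at hx
    simp only [mem_filter, mem_univ, true_and]
    rcases hx with rfl | rfl | rfl <;> assumption
  have hcard : #({p, q, r} : Finset (Pr h)) = 3 := card_eq_three.2 ⟨p, q, r, hq.symm, hr.symm, hqr, rfl⟩
  rw [← hcard]
  exact card_le_card hs

/-- Chains inside the pieces. -/
lemma piece_chain (hdisj : ∀ i j, i ≠ j → ∀ v, v ∈ B i → v ∉ B j)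
    (hconn : ∀ p, (conn p).fst ∈ B p.1.1 ∧ (conn p).snd ∈ B p.1.2)
    (root : Fin h → V) (hrc : ∀ i, RC G (B i) (root i)) (i : Fin h) {u v : V}
    (hu : u ∈ B i) (hv : v ∈ B i) : ∃ c : G.edgeSet → ZMod 2,
    dV G c = Pi.single u 1 + Pi.single v 1 ∧ (∀ d, c (ed d) ≠ 0 → Alw B conn d) ∧
      ∀ p, c (ed (conn p)) = 0 := by
  obtain ⟨p, hp⟩ := (hrc i).2 u hu
  obtain ⟨q, hq⟩ := (hrc i).2 v hv
  obtain ⟨c, hc1, hc2⟩ := walk_chain (p.reverse.append q)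
  have hin : ∀ w ∈ (p.reverse.append q).support, w ∈ B i := by
    intro w hw
    rw [SimpleGraph.Walk.mem_support_append_iff] at hw
    rcases hw with hw | hw
    · rw [SimpleGraph.Walk.support_reverse, List.mem_reverse] at hw; exact hp w hw
    · exact hq w hw
  refine ⟨c, hc1, fun d hd => Or.inl ⟨i, hin _ (hc2 d hd).1, hin _ (hc2 d hd).2⟩, fun r => ?_⟩
  by_contra hne
  have h1 := hc2 _ hne
  have e1 := B_unique hdisj (hin _ h1.1) (hconn r).1
  have e2 := B_unique hdisj (hin _ h1.2) (hconn r).2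
  exact r.2.ne (e1.symm.trans e2)

end Count

/-- Shifted pair. -/
def sh {n : ℕ} (p : Pr n) : Pr (n + 1) := ⟨(p.1.1.succ, p.1.2.succ), Fin.succ_lt_succ_iff.2 p.2⟩

/-- Pair with zero. -/
def z0 {n : ℕ} (i : Fin n) : Pr (n + 1) := ⟨(0, i.succ), Fin.succ_pos i⟩

lemma sh_inj {n : ℕ} {p q : Pr n} (h : sh p = sh q) : p = q := by
  have := Subtype.ext_iff.1 h
  simp only [sh, Prod.mk.injEq, Fin.succ_inj] at this
  exact Subtype.ext (Prod.ext this.1 this.2)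

lemma sh_ne_z0 {n : ℕ} (p : Pr n) (i : Fin n) : sh p ≠ z0 i := by
  intro h
  have := Subtype.ext_iff.1 h
  simp only [sh, z0, Prod.mk.injEq] at this
  exact Fin.succ_ne_zero _ this.1

/-- Restriction to connectors away from zero. -/
noncomputable def pi1 {n : ℕ} (conn : Pr (n + 1) → G.Dart) :
    (G.edgeSet → ZMod 2) →ₗ[ZMod 2] (Pr n → ZMod 2) :=
  LinearMap.funLeft (ZMod 2) (ZMod 2) (fun p => ed (conn (sh p)))

lemma pi1_surj {n : ℕ} {B : Fin (n + 1) → Set V} {conn : Pr (n + 1) → G.Dart}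
    (hdisj : ∀ i j, i ≠ j → ∀ v, v ∈ B i → v ∉ B j)
    (hconn : ∀ p, (conn p).fst ∈ B p.1.1 ∧ (conn p).snd ∈ B p.1.2)
    (root : Fin (n + 1) → V) (hrc : ∀ i, RC G (B i) (root i)) :
    (CA B conn).map (pi1 conn) = ⊤ := by
  rw [eq_top_iff, ← (Pi.basisFun (ZMod 2) (Pr n)).span_eq, Submodule.span_le]
  rintro _ ⟨p, rfl⟩
  rw [Pi.basisFun_apply]
  set k := p.1.1
  set l := p.1.2
  obtain ⟨c0, a1, a2, a3⟩ := piece_chain hdisj hconn root hrc 0 (hconn (z0 k)).1 (hconn (z0 l)).1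
  obtain ⟨ck, b1, b2, b3⟩ := piece_chain hdisj hconn root hrc k.succ (hconn (z0 k)).2 (hconn (sh p)).1
  obtain ⟨cl, d1, d2, d3⟩ := piece_chain hdisj hconn root hrc l.succ (hconn (z0 l)).2 (hconn (sh p)).2
  have hS : ∀ q, ∀ d : G.Dart, (Pi.single (ed (conn q)) 1 : G.edgeSet → ZMod 2) (ed d) ≠ 0 → Alw B conn d := by
    intro q d hd
    refine Or.inr ⟨q, ?_⟩
    by_contra hne
    rw [Pi.single_apply, if_neg hne] at hd; exact hd rfl
  have addc : ∀ c c' : G.edgeSet → ZMod 2, (∀ d : G.Dart, c (ed d) ≠ 0 → Alw B conn d) →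
      (∀ d : G.Dart, c' (ed d) ≠ 0 → Alw B conn d) → (∀ d : G.Dart, (c + c') (ed d) ≠ 0 → Alw B conn d) := by
    intro c c' h1 h2 d hd
    by_cases h : c (ed d) = 0
    · exact h2 d (fun h' => hd (by rw [Pi.add_apply, h, h', add_zero]))
    · exact h1 d h
  refine ⟨Pi.single (ed (conn (sh p))) 1 + Pi.single (ed (conn (z0 k))) 1 + Pi.single (ed (conn (z0 l))) 1
    + c0 + ck + cl, ⟨?_, ?_⟩, ?_⟩
  · rw [map_add, map_add, map_add, map_add, map_add, dV_single, dV_single, dV_single, a1, b1, d1]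
    have t : ∀ x : V → ZMod 2, x + x = 0 := fun x => by ext v; exact z2_add_self _
    generalize (Pi.single (conn (sh p)).toProd.1 1 : V → ZMod 2) = x1
    generalize (Pi.single (conn (sh p)).toProd.2 1 : V → ZMod 2) = x2
    generalize (Pi.single (conn (z0 k)).toProd.1 1 : V → ZMod 2) = x3
    generalize (Pi.single (conn (z0 k)).toProd.2 1 : V → ZMod 2) = x4
    generalize (Pi.single (conn (z0 l)).toProd.1 1 : V → ZMod 2) = x5
    generalize (Pi.single (conn (z0 l)).toProd.2 1 : V → ZMod 2) = x6
    calc _ = (x1 + x1) + (x2 + x2) + (x3 + x3) + (x4 + x4) + (x5 + x5) + (x6 + x6) := by abel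
      _ = 0 := by simp only [t]
  · exact addc _ _ (addc _ _ (addc _ _ (addc _ _ (addc _ _ (hS _) (hS _)) (hS _)) a2) b2) d2
  · ext q
    show (Pi.single (ed (conn (sh p))) 1 + Pi.single (ed (conn (z0 k))) 1 + Pi.single (ed (conn (z0 l))) 1
      + c0 + ck + cl : G.edgeSet → ZMod 2) (ed (conn (sh q))) = (Pi.single p 1 : Pr n → ZMod 2) q
    simp only [Pi.add_apply]
    rw [a3, b3, d3, add_zero, add_zero, add_zero]
    have e1 : ∀ i, ed (conn (sh q)) ≠ ed (conn (z0 i)) := fun i he =>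
      sh_ne_z0 q i (conn_inj hdisj hconn he)
    have e2 : ed (conn (sh q)) = ed (conn (sh p)) ↔ q = p :=
      ⟨fun he => sh_inj (conn_inj hdisj hconn he), fun he => by rw [he]⟩
    simp only [Pi.single_apply, e1, if_false, add_zero, e2]

lemma finrank_map_add {M N : Type} [AddCommGroup M] [Module (ZMod 2) M] [AddCommGroup N]
    [Module (ZMod 2) N] [FiniteDimensional (ZMod 2) M] (f : M →ₗ[ZMod 2] N) (S : Submodule (ZMod 2) M) :
    Module.finrank (ZMod 2) (S.map f) + Module.finrank (ZMod 2) (S ⊓ LinearMap.ker f : Submodule (ZMod 2) M) =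
      Module.finrank (ZMod 2) S := by
  have h1 := LinearMap.finrank_range_add_finrank_ker (f.domRestrict S)
  rw [LinearMap.range_domRestrict, LinearMap.ker_domRestrict] at h1
  rw [← h1, ← Submodule.map_comap_subtype, Submodule.finrank_map_subtype_eq]

theorem no_minor (hc : G.Connected) (hV : 2 ≤ Nat.card V) {g : ℕ} (hg : minGenus G = g) :
    IsEmpty (Minor G (12 * g + 7)) := by
  refine ⟨fun m => ?_⟩
  obtain ⟨rs, hrs⟩ := genus_attained hc hV hg
  have hcod := codim_le hc rs g hrs
  obtain ⟨n, hn⟩ : ∃ n, n = 12 * g + 6 := ⟨_, rfl⟩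
  have hh : 12 * g + 7 = n + 1 := by omega
  rw [hh] at m
  obtain ⟨B, root, hrc, hdisj, hedge⟩ := m
  have hex : ∀ p : Pr (n + 1), ∃ d : G.Dart, d.fst ∈ B p.1.1 ∧ d.snd ∈ B p.1.2 := by
    intro p
    obtain ⟨a, ha, b, hb, hab⟩ := hedge p.1.1 p.1.2 p.2.ne
    exact ⟨⟨(a, b), hab⟩, ha, hb⟩
  choose conn hconn using hex
  have hsurj := pi1_surj hdisj hconn root hrc
  set C := CA B conn with hC
  set R := LinearMap.range (dF rs) with hR
  -- dimension count
  have d1 : Fintype.card (Pr n) ≤ Module.finrank (ZMod 2) ((C ⊓ R).map (pi1 conn)) + 2 * g := by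
    have e1 := finrank_map_add (pi1 conn) C
    have e2 := finrank_map_add (pi1 conn) (C ⊓ R)
    rw [hsurj, finrank_top, Module.finrank_fintype_fun_eq_card] at e1
    have e3 := Submodule.finrank_sup_add_finrank_inf_eq C R
    have e4 : Module.finrank (ZMod 2) (C ⊔ R : Submodule (ZMod 2) (G.edgeSet → ZMod 2)) ≤
        Module.finrank (ZMod 2) (LinearMap.ker (dV G)) :=
      Submodule.finrank_mono (sup_le (fun c hc => hc.1) (range_le_ker rs))
    have e5 : Module.finrank (ZMod 2) (C ⊓ R ⊓ LinearMap.ker (pi1 conn) : Submodule (ZMod 2) (G.edgeSet → ZMod 2)) ≤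
        Module.finrank (ZMod 2) (C ⊓ LinearMap.ker (pi1 conn) : Submodule (ZMod 2) (G.edgeSet → ZMod 2)) :=
      Submodule.finrank_mono (inf_le_inf_right _ inf_le_left)
    omega
  -- classes of faces
  let rel : Fa rs → Fa rs → Prop := fun a b => ∃ d, ¬ Alw B conn d ∧ a = face rs d ∧ b = face rs d.symm
  let Cl : Type := Quot rel
  let cl : Fa rs → Cl := Quot.mk rel
  have : Finite Cl := Quot.finite rel
  let _ : Fintype Cl := Fintype.ofFinite Cl
  let L : (Cl → ZMod 2) →ₗ[ZMod 2] (G.edgeSet → ZMod 2) := dF rs ∘ₗ LinearMap.funLeft (ZMod 2) (ZMod 2) cl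
  have hL : ∀ T d, L T (ed d) = T (cl (face rs d)) + T (cl (face rs d.symm)) := fun T d =>
    dF_apply rs _ d
  have hLC : ∀ T, L T ∈ C := by
    intro T
    refine ⟨dV_dF rs _, fun d hd => ?_⟩
    by_contra hal
    have : cl (face rs d) = cl (face rs d.symm) := Quot.sound ⟨d, hal, rfl, rfl⟩
    rw [hL, this] at hd
    exact hd (z2_add_self _)
  let cq : Cl → G.edgeSet → ZMod 2 := fun q => L (Pi.single q 1)
  let good : Finset Cl := univ.filter (fun q => ∃ p, cq q (ed (conn p)) ≠ 0)
  have d2 : Module.finrank (ZMod 2) ((C ⊓ R).map (pi1 conn)) ≤ #good := by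
    have hle : (C ⊓ R).map (pi1 conn) ≤
        Submodule.span (ZMod 2) (↑(good.image (fun q => pi1 conn (cq q))) : Set (Pr n → ZMod 2)) := by
      rintro _ ⟨c, ⟨hcC, ⟨S, rfl⟩⟩, rfl⟩
      have hSr : ∀ a b, rel a b → S a = S b := by
        rintro _ _ ⟨d, hd, rfl, rfl⟩
        by_contra hne
        refine hd (hcC.2 d (fun h0 => hne ?_))
        rw [dF_apply] at h0
        exact z2_eq_of_add _ _ h0
      let T : Cl → ZMod 2 := Quot.lift S hSr
      have hT : dF rs S = L T := rfl
      rw [hT, LinearMap.pi_apply_eq_sum_univ L T, map_sum]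
      refine Submodule.sum_mem _ fun q _ => ?_
      rw [map_smul]
      refine Submodule.smul_mem _ _ ?_
      have hsing : (fun j => if q = j then (1 : ZMod 2) else 0) = Pi.single q 1 := by
        ext j; simp [Pi.single_apply, eq_comm]
      rw [hsing]
      by_cases hq : q ∈ good
      · exact Submodule.subset_span (by
          rw [coe_image]; exact ⟨q, hq, rfl⟩)
      · have : pi1 conn (L (Pi.single q 1)) = 0 := by
          ext p
          by_contra hne
          exact hq (by simp only [good, mem_filter, mem_univ, true_and]; exact ⟨sh p, hne⟩)
        rw [this]; exact Submodule.zero_mem _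
    refine (Submodule.finrank_mono hle).trans ?_
    exact (finrank_span_finset_le_card _).trans card_image_le
  have d3 : 3 * #good ≤ 2 * Fintype.card (Pr (n + 1)) := by
    have s1 : ∑ q ∈ good, 3 ≤ ∑ q ∈ good, #(univ.filter (fun p => cq q (ed (conn p)) ≠ 0)) := by
      refine sum_le_sum fun q hq => ?_
      simp only [good, mem_filter, mem_univ, true_and] at hq
      obtain ⟨p, hp⟩ := hq
      exact three_le hdisj hconn (hLC _) hp
    have s2 : ∑ q ∈ good, #(univ.filter (fun p => cq q (ed (conn p)) ≠ 0)) =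
        ∑ p : Pr (n + 1), #(good.filter (fun q => cq q (ed (conn p)) ≠ 0)) := by
      simp only [card_filter]
      rw [sum_comm]
    have s3 : ∑ p : Pr (n + 1), #(good.filter (fun q => cq q (ed (conn p)) ≠ 0)) ≤ ∑ p : Pr (n + 1), 2 := by
      refine sum_le_sum fun p _ => ?_
      have hsub : good.filter (fun q => cq q (ed (conn p)) ≠ 0) ⊆
          {cl (face rs (conn p)), cl (face rs (conn p).symm)} := by
        intro q hq
        rw [mem_filter] at hq
        by_contra hne
        simp only [mem_insert, mem_singleton, not_or] at hne
        apply hq.2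
        simp only [cq]
        rw [hL, Pi.single_apply, Pi.single_apply, if_neg (fun e => hne.1 e.symm),
          if_neg (fun e => hne.2 e.symm), add_zero]
      exact (card_le_card hsub).trans card_le_two
    rw [sum_const, smul_eq_mul] at s1
    rw [sum_const, smul_eq_mul, card_univ] at s3
    omega
  have c1 := card_Pr n
  have c2 := card_Pr (n + 1)
  subst hn
  nlinarith

end ResAux

open CoverTimePaper in
/-- Let `{G k}` be an increasing sequence of finite connected simple
graphs with maximum degree `Δ` and minimum genus `g` satisfying (A1), (A2), (A3).  Then
there are positive constants `A'` and `c` (one may take `c = 1/6`) such that for all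
sufficiently large `k` and every subset `W ⊆ V k` there is a subset `Z ⊆ W` with
`|Z| ≥ |W|^c / (g+1)` such that all distinct `u, w ∈ Z` satisfy
`R_{G k}(u, w) ≥ (A' / (Δ (g+1))) · c · log |W|`. -/
theorem resistance_subset (Δ g : ℕ) (J : JSSequence Δ g) :
    ∃ A' : ℝ, 0 < A' ∧ ∃ c : ℝ, 0 < c ∧ ∃ K : ℕ, ∀ k ≥ K,
      ∀ W : Finset (J.V k), ∃ Z : Finset (J.V k), Z ⊆ W ∧
        ((W.card : ℝ) ^ c) / ((g : ℝ) + 1) ≤ (Z.card : ℝ) ∧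
        ∀ u ∈ Z, ∀ w ∈ Z, u ≠ w →
          (A' / ((Δ : ℝ) * ((g : ℝ) + 1))) * c * Real.log (W.card)
            ≤ effRes (J.G k) u w := by
  refine ResAux.assembly Δ g (12 * g + 7) (by omega) J
    (fun k hk => ResAux.no_minor (J.conn k) ?_ (J.genus k))
  obtain ⟨j, rfl⟩ : ∃ j, k = j + 1 := ⟨k - 1, by omega⟩
  have h1 := J.increasing j
  have h2 : 0 < Nat.card (J.V j) := Nat.card_pos
  omega
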